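/- arXiv:1303.0523 — 6 statements merged into one kernel-verified Lean document; each statement's English description precedes it below -/
import Mathlib

section
/- For every finite connected graph G and every integer t ≥ 1 with 2t ≤ |V(G)|, one has VR(G, t) ≥ (1/2)·VR(G, 1). -/
open SimpleGraph

variable {V : Type*}

/-- Distance from a vertex to a finite set of vertices (`⊤` if the set is empty). -/
noncomputable def distToSet (G : SimpleGraph V) (S : Finset V) (v : V) : ℕ∞ :=
  S.inf fun a => (G.dist a v : ℕ∞)

/-- Player A's Voronoi score. -/
noncomputable def scoreA [Fintype V] (G : SimpleGraph V) (A B : Finset V) : ℝ :=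
  ∑ v : V,
    if distToSet G A v < distToSet G B v then 1
    else if distToSet G A v = distToSet G B v then 1/2 else 0

/-- Player B's Voronoi score. -/
noncomputable def scoreB [Fintype V] (G : SimpleGraph V) (A B : Finset V) : ℝ :=
  ∑ v : V,
    if distToSet G B v < distToSet G A v then 1
    else if distToSet G B v = distToSet G A v then 1/2 else 0

/-- Minimax value (A's score under optimal play) of the Voronoi game with `t`
remaining rounds, given the sets of vertices already claimed by A and B. -/
noncomputable def gameValue [Fintype V] [DecidableEq V] (G : SimpleGraph V) :
    ℕ → Finset V → Finset V → ℝ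
  | 0, A, B => scoreA G A B
  | (t+1), A, B =>
      sSup {r : ℝ | ∃ a, a ∉ A ∧ a ∉ B ∧
        r = sInf {s : ℝ | ∃ b, b ∉ insert a A ∧ b ∉ B ∧
          s = gameValue G t (insert a A) (insert b B)}}

/-- The Voronoi ratio of `G` for a `t`-round game. -/
noncomputable def VR [Fintype V] [DecidableEq V] (G : SimpleGraph V) (t : ℕ) : ℝ :=
  gameValue G t ∅ ∅ / (Fintype.card V)

/-- Pointwise contribution to the score. -/
noncomputable def ptScore (x y : ℕ∞) : ℝ :=
  if x < y then 1 else if x = y then 1/2 else 0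

lemma scoreA_eq_sum [Fintype V] (G : SimpleGraph V) (A B : Finset V) :
    scoreA G A B = ∑ v : V, ptScore (distToSet G A v) (distToSet G B v) := rfl

lemma ptScore_le_one (x y : ℕ∞) : ptScore x y ≤ 1 := by
  unfold ptScore; split_ifs <;> norm_num

/-- `p` is the real A set, `x` the B set, `y` the pretended set without its last move. -/
lemma ptScore_exchange (p x y a c : ℕ∞) (h : p ≤ min a y) :
    ptScore a c ≤ ptScore p x + ptScore x (min c y) := by
  have h1 : p ≤ a := h.trans (min_le_left _ _)
  have h2 : p ≤ y := h.trans (min_le_right _ _)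
  unfold ptScore
  rcases lt_trichotomy p x with hp | hp | hp
  · rw [if_pos hp]; split_ifs <;> norm_num
  · subst hp
    rw [if_neg (lt_irrefl p), if_pos rfl]
    by_cases hac : a < c
    · have : p ≤ min c y := le_min (h1.trans hac.le) h2
      rcases this.lt_or_eq with h3 | h3
      · rw [if_pos h3]; split_ifs <;> norm_num
      · rw [if_pos hac, if_neg (not_lt.mpr h3.ge), if_pos h3]; norm_num
    · rw [if_neg hac]; split_ifs <;> norm_num
  · rw [if_neg (not_lt.mpr hp.le), if_neg hp.ne']
    have hxy : x < y := hp.trans_le h2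
    have hxa : x < a := hp.trans_le h1
    by_cases hac : a < c
    · rw [if_pos (lt_min (hxa.trans hac) hxy)]; split_ifs; norm_num
    · by_cases hac' : a = c
      · subst hac'
        rw [if_pos (lt_min hxa hxy)]; simp; norm_num
      · rw [if_neg hac, if_neg hac']; split_ifs <;> norm_num

lemma ptScore_self_exchange (p x q : ℕ∞) (h : p ≤ q) :
    1 ≤ ptScore p x + ptScore x q := by
  unfold ptScore
  rcases lt_trichotomy p x with hp | hp | hp
  · rw [if_pos hp]; split_ifs <;> norm_num
  · subst hp
    rw [if_neg (lt_irrefl p), if_pos rfl]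
    rcases h.lt_or_eq with h3 | h3
    · rw [if_pos h3]; norm_num
    · rw [if_neg (not_lt.mpr h3.ge), if_pos h3]; norm_num
  · rw [if_pos (hp.trans_le h)]; split_ifs <;> norm_num

lemma distToSet_insert [DecidableEq V] (G : SimpleGraph V) (S : Finset V) (c v : V) :
    distToSet G (insert c S) v = min (distToSet G {c} v) (distToSet G S v) := by
  simp [distToSet, Finset.inf_insert]

lemma distToSet_anti (G : SimpleGraph V) {S T : Finset V} (h : S ⊆ T) (v : V) :
    distToSet G T v ≤ distToSet G S v := Finset.inf_mono h

lemma scoreA_le_card [Fintype V] (G : SimpleGraph V) (A B : Finset V) :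
    scoreA G A B ≤ Fintype.card V := by
  rw [scoreA_eq_sum]
  calc _ ≤ ∑ _v : V, (1 : ℝ) := Finset.sum_le_sum fun _ _ => ptScore_le_one _ _
    _ = _ := by simp

lemma score_exchange [Fintype V] [DecidableEq V] (G : SimpleGraph V)
    (A X Y : Finset V) (a c : V) (M : ℝ)
    (hM : ∀ c, c ≠ a → M ≤ scoreA G {a} {c}) (hM' : M ≤ Fintype.card V)
    (hA : insert a Y ⊆ A) :
    M ≤ scoreA G A X + scoreA G X (insert c Y) := by
  rw [scoreA_eq_sum, scoreA_eq_sum, ← Finset.sum_add_distrib]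
  by_cases hc : c = a
  · subst hc
    refine hM'.trans ?_
    calc (Fintype.card V : ℝ) = ∑ _v : V, (1 : ℝ) := by simp
      _ ≤ _ := Finset.sum_le_sum fun v _ => ptScore_self_exchange _ _ _ (distToSet_anti G hA v)
  · refine (hM c hc).trans ?_
    rw [scoreA_eq_sum]
    refine Finset.sum_le_sum fun v _ => ?_
    rw [distToSet_insert]
    apply ptScore_exchange
    rw [← distToSet_insert]
    exact distToSet_anti G hA v

lemma finite_choice [Finite V] (p q : V → Prop) (f : V → ℝ) :
    {s : ℝ | ∃ b, p b ∧ q b ∧ s = f b}.Finite := by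
  refine (Set.finite_range f).subset ?_
  rintro _ ⟨b, _, _, rfl⟩
  exact ⟨b, rfl⟩

lemma exists_free [Fintype V] [DecidableEq V] (A B : Finset V)
    (h : A.card + B.card < Fintype.card V) : ∃ b, b ∉ A ∧ b ∉ B := by
  by_contra! hcon
  have : (Finset.univ : Finset V) ⊆ A ∪ B := fun b _ => by
    by_cases hb : b ∈ A
    · exact Finset.mem_union_left _ hb
    · exact Finset.mem_union_right _ (hcon b hb)
  have h1 := Finset.card_le_card this
  have h2 := Finset.card_union_le A B
  rw [Finset.card_univ] at h1
  omega

/-- Value of the game when B is to move and `k` full rounds remain afterwards. -/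
noncomputable def innerValue [Fintype V] [DecidableEq V] (G : SimpleGraph V) (k : ℕ)
    (A B : Finset V) : ℝ :=
  sInf {s : ℝ | ∃ b, b ∉ A ∧ b ∉ B ∧ s = gameValue G k A (insert b B)}

lemma innerValue_le_gameValue [Fintype V] [DecidableEq V] (G : SimpleGraph V) (k : ℕ)
    (A B : Finset V) (a : V) (ha : a ∉ A) (hb : a ∉ B) :
    innerValue G k (insert a A) B ≤ gameValue G (k+1) A B := by
  rw [gameValue]
  exact le_csSup (finite_choice _ _ _).bddAbove ⟨a, ha, hb, rfl⟩

lemma steal [Fintype V] [DecidableEq V] (G : SimpleGraph V) (a : V) (M : ℝ)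
    (hM : ∀ c, c ≠ a → M ≤ scoreA G {a} {c}) (hM' : M ≤ Fintype.card V) (k : ℕ) :
    ∀ A X Y : Finset V, insert a Y ⊆ A → Y.card < A.card →
      A.card + X.card + 2 * k + 1 ≤ Fintype.card V →
      M ≤ innerValue G k A X + gameValue G (k+1) X Y := by
  induction k with
  | zero =>
    intro A X Y hA hY hcard
    rw [← sub_le_iff_le_add]
    refine le_csInf ?_ ?_
    · obtain ⟨b, h1, h2⟩ := exists_free A X (by omega)
      exact ⟨_, b, h1, h2, rfl⟩
    rintro _ ⟨b, hbA, hbX, rfl⟩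
    have hbY : b ∉ Y := fun h => hbA (hA (Finset.mem_insert_of_mem h))
    have h1 := innerValue_le_gameValue G 0 X Y b hbX hbY
    obtain ⟨c, hc1, hc2, hc⟩ : innerValue G 0 (insert b X) Y ∈ _ :=
      Set.Nonempty.csInf_mem (by
        obtain ⟨c, h1, h2⟩ := exists_free (insert b X) Y (by
          have := Finset.card_insert_le b X; omega)
        exact ⟨_, c, h1, h2, rfl⟩) (finite_choice _ _ _)
    rw [hc] at h1
    have h2 := score_exchange G A (insert b X) Y a c M hM hM' hA
    simp only [gameValue] at h1 ⊢
    linarith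
  | succ k ih =>
    intro A X Y hA hY hcard
    rw [← sub_le_iff_le_add]
    refine le_csInf ?_ ?_
    · obtain ⟨b, h1, h2⟩ := exists_free A X (by omega)
      exact ⟨_, b, h1, h2, rfl⟩
    rintro _ ⟨b, hbA, hbX, rfl⟩
    have hbY : b ∉ Y := fun h => hbA (hA (Finset.mem_insert_of_mem h))
    have hbc := Finset.card_insert_le b X
    have h1 := innerValue_le_gameValue G (k+1) X Y b hbX hbY
    obtain ⟨c, hc1, hc2, hc⟩ : innerValue G (k+1) (insert b X) Y ∈ _ :=
      Set.Nonempty.csInf_mem (by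
        obtain ⟨c, h1, h2⟩ := exists_free (insert b X) Y (by omega)
        exact ⟨_, c, h1, h2, rfl⟩) (finite_choice _ _ _)
    rw [hc] at h1
    obtain ⟨d, hdA, hdX, hdc⟩ : ∃ d, d ∉ A ∧ d ∉ insert b X ∧ c ∈ insert d A := by
      by_cases hcA : c ∈ A
      · obtain ⟨d, h1, h2⟩ := exists_free A (insert b X) (by omega)
        exact ⟨d, h1, h2, Finset.mem_insert_of_mem hcA⟩
      · exact ⟨c, hcA, hc1, Finset.mem_insert_self _ _⟩
    have h2 := innerValue_le_gameValue G k A (insert b X) d hdA hdX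
    have hdcard := Finset.card_insert_of_notMem hdA
    have h3 := ih (insert d A) (insert b X) (insert c Y) (by
        intro z hz
        simp only [Finset.mem_insert] at hz
        rcases hz with rfl | rfl | hz
        · exact Finset.mem_insert_of_mem (hA (Finset.mem_insert_self _ _))
        · exact hdc
        · exact Finset.mem_insert_of_mem (hA (Finset.mem_insert_of_mem hz)))
      (by have := Finset.card_insert_le c Y; omega) (by omega)
    linarith

/-- For every finite connected graph `G` and every integer `t ≥ 1` with
`2t ≤ |V(G)|`, one has `VR(G, t) ≥ (1/2)·VR(G, 1)`. -/
theorem vr_general_lower_bound {V : Type*} [Fintype V] [DecidableEq V]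
    (G : SimpleGraph V) (hG : G.Connected) (t : ℕ) (ht : 1 ≤ t)
    (h2t : 2 * t ≤ Fintype.card V) :
    (1 / 2 : ℝ) * VR G 1 ≤ VR G t := by
  obtain ⟨k, rfl⟩ : ∃ k, t = k + 1 := ⟨t - 1, by omega⟩
  suffices h : gameValue G 1 ∅ ∅ ≤ gameValue G (k+1) ∅ ∅ + gameValue G (k+1) ∅ ∅ by
    unfold VR
    rw [← mul_div_assoc]
    apply div_le_div_of_nonneg_right _ (Nat.cast_nonneg _)
    linarith
  obtain ⟨a, -, -, ha⟩ : gameValue G 1 ∅ ∅ ∈ _ := by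
    rw [gameValue]
    refine Set.Nonempty.csSup_mem ?_ (finite_choice _ _ _)
    obtain ⟨c, h1, h2⟩ := exists_free (∅ : Finset V) ∅ (by simp; omega)
    exact ⟨_, c, h1, h2, rfl⟩
  have hM : ∀ c, c ≠ a → gameValue G 1 ∅ ∅ ≤ scoreA G {a} {c} := by
    intro c hc
    rw [ha]
    exact csInf_le (finite_choice _ _ _).bddBelow ⟨c, by simpa using hc, by simp, by simp [gameValue]⟩
  have hM' : gameValue G 1 ∅ ∅ ≤ Fintype.card V := by
    obtain ⟨c, h1, -⟩ := exists_free ({a} : Finset V) ∅ (by simp; omega)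
    exact (hM c (by simpa using h1)).trans (scoreA_le_card _ _ _)
  have h1 := steal G a _ hM hM' k {a} ∅ ∅ (by simp) (by simp) (by simp; omega)
  have h2 := innerValue_le_gameValue G k ∅ ∅ a (by simp) (by simp)
  have h3 : innerValue G k (insert a ∅) ∅ = innerValue G k {a} ∅ := rfl
  linarith
end

section
/- For every finite connected graph G and every integer t ≥ 1 with 2t ≤ |V(G)|, one has VR(G, t) ≤ (1/2)·(VR(G, 1) + 1). -/
open SimpleGraph

variable {V : Type*}

/-- Value when the second player is to move and `k` full rounds remain afterwards. -/
noncomputable def replyValue {V : Type*} [Fintype V] [DecidableEq V] (G : SimpleGraph V)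
    (k : ℕ) (A B : Finset V) : ℝ :=
  sInf {s : ℝ | ∃ b, b ∉ A ∧ b ∉ B ∧ s = gameValue G k A (insert b B)}

theorem gameValue_succ {V : Type*} [Fintype V] [DecidableEq V] (G : SimpleGraph V)
    (k : ℕ) (A B : Finset V) : gameValue G (k+1) A B =
      sSup {r : ℝ | ∃ a, a ∉ A ∧ a ∉ B ∧ r = replyValue G k (insert a A) B} := by
  simp only [gameValue, replyValue]

theorem finite_moves {V : Type*} [Fintype V] (P Q : V → Prop) (f : V → ℝ) :
    {s : ℝ | ∃ b, P b ∧ Q b ∧ s = f b}.Finite := by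
  refine (Set.finite_range f).subset ?_
  rintro s ⟨b, -, -, rfl⟩
  exact ⟨b, rfl⟩

theorem sSup_mem_moves {V : Type*} [Fintype V] (P Q : V → Prop) (f : V → ℝ) (b : V)
    (hP : P b) (hQ : Q b) :
    ∃ c, P c ∧ Q c ∧ sSup {s : ℝ | ∃ b, P b ∧ Q b ∧ s = f b} = f c :=
  Set.Nonempty.csSup_mem (s := {s : ℝ | ∃ b, P b ∧ Q b ∧ s = f b})
    ⟨_, b, hP, hQ, rfl⟩ (finite_moves P Q f)

theorem sInf_mem_moves {V : Type*} [Fintype V] (P Q : V → Prop) (f : V → ℝ) (b : V)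
    (hP : P b) (hQ : Q b) :
    ∃ c, P c ∧ Q c ∧ sInf {s : ℝ | ∃ b, P b ∧ Q b ∧ s = f b} = f c :=
  Set.Nonempty.csInf_mem (s := {s : ℝ | ∃ b, P b ∧ Q b ∧ s = f b})
    ⟨_, b, hP, hQ, rfl⟩ (finite_moves P Q f)

theorem replyValue_le {V : Type*} [Fintype V] [DecidableEq V] (G : SimpleGraph V)
    (k : ℕ) (A B : Finset V) (b : V) (hA : b ∉ A) (hB : b ∉ B) :
    replyValue G k A B ≤ gameValue G k A (insert b B) :=
  csInf_le (finite_moves _ _ _).bddBelow ⟨b, hA, hB, rfl⟩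

theorem scoreA_nonneg {V : Type*} [Fintype V] (G : SimpleGraph V) (A B : Finset V) :
    0 ≤ scoreA G A B := by
  unfold scoreA
  apply Finset.sum_nonneg
  intro v _
  split_ifs <;> norm_num

theorem scoreA_le {V : Type*} [Fintype V] (G : SimpleGraph V) (A B : Finset V) :
    scoreA G A B ≤ Fintype.card V := by
  unfold scoreA
  refine (Finset.sum_le_sum (g := fun _ => (1 : ℝ)) ?_).trans ?_
  · intro v _
    split_ifs <;> norm_num
  · simp

theorem replyValue_bounds_of {V : Type*} [Fintype V] [DecidableEq V] (G : SimpleGraph V)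
    (k : ℕ) (h : ∀ A B, 0 ≤ gameValue G k A B ∧ gameValue G k A B ≤ Fintype.card V)
    (A B : Finset V) :
    0 ≤ replyValue G k A B ∧ replyValue G k A B ≤ Fintype.card V := by
  by_cases hex : ∃ b, b ∉ A ∧ b ∉ B
  · obtain ⟨b, hA, hB⟩ := hex
    obtain ⟨c, -, -, hc⟩ := sInf_mem_moves (fun b => b ∉ A) (fun b => b ∉ B)
      (fun b => gameValue G k A (insert b B)) b hA hB
    rw [replyValue, hc]
    exact h _ _
  · have : {s : ℝ | ∃ b, b ∉ A ∧ b ∉ B ∧ s = gameValue G k A (insert b B)} = ∅ := by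
      ext s
      simp only [Set.mem_ofPred_eq, Set.mem_empty_iff_false, iff_false]
      rintro ⟨b, h1, h2, -⟩
      exact hex ⟨b, h1, h2⟩
    rw [replyValue, this, Real.sInf_empty]
    exact ⟨le_rfl, by positivity⟩

theorem gameValue_bounds {V : Type*} [Fintype V] [DecidableEq V] (G : SimpleGraph V)
    (k : ℕ) : ∀ A B, 0 ≤ gameValue G k A B ∧ gameValue G k A B ≤ Fintype.card V := by
  induction k with
  | zero =>
    intro A B
    simp only [gameValue]
    exact ⟨scoreA_nonneg G A B, scoreA_le G A B⟩
  | succ k ih =>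
    intro A B
    rw [gameValue_succ]
    constructor
    · apply Real.sSup_nonneg
      rintro r ⟨a, -, -, rfl⟩
      exact (replyValue_bounds_of G k ih _ _).1
    · apply Real.sSup_le
      · rintro r ⟨a, -, -, rfl⟩
        exact (replyValue_bounds_of G k ih _ _).2
      · positivity

/-- Pointwise comparison of the real game, the imagined game and the one-round game. -/
theorem pointwise_bound (a b x w y : ℕ∞) (h : b = y ∨ x ≤ b) :
    ((if min a w < min y x then 1 else if min a w = min y x then 1/2 else 0 : ℝ)
      + (if min a x < min y w then 1 else if min a x = min y w then 1/2 else 0 : ℝ))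
      ≤ 1 + (if a < b then 1 else if a = b then 1/2 else 0 : ℝ) := by
  rcases lt_trichotomy a b with hab | hab | hab
  · rw [if_pos hab]
    split_ifs <;> norm_num
  · rw [if_neg hab.not_lt, if_pos hab]
    have : ¬ (min a w < min y x ∧ min a x < min y w) := by
      rintro ⟨h1, h2⟩
      simp only [min_lt_iff, lt_min_iff] at h1 h2
      rcases h with h | h <;> grind
    split_ifs <;> first | (exfalso; tauto) | norm_num
  · rw [if_neg hab.not_gt, if_neg hab.ne']
    have h1 : min a w < min y x → min y w < min a x := by
      simp only [min_lt_iff, lt_min_iff]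
      rcases h with h | h <;> grind
    have h2 : min a x < min y w → min y x < min a w := by
      simp only [min_lt_iff, lt_min_iff]
      rcases h with h | h <;> grind
    split_ifs with p q r s t u <;>
      first
      | (exfalso; have := h1 p; order)
      | (exfalso; have := h2 (by assumption); order)
      | norm_num

theorem score_bound {V : Type*} [Fintype V] [DecidableEq V] (G : SimpleGraph V)
    (a1 b1 y : V) (A B : Finset V) (hb : b1 ∈ insert y B) :
    scoreA G (insert a1 A) (insert y B) + scoreA G (insert a1 B) (insert y A)
      ≤ Fintype.card V + scoreA G {a1} {b1} := by
  have hcard : (Fintype.card V : ℝ) = ∑ _v : V, (1 : ℝ) := by simp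
  unfold scoreA
  rw [hcard, ← Finset.sum_add_distrib, ← Finset.sum_add_distrib]
  apply Finset.sum_le_sum
  intro v _
  have key := pointwise_bound (G.dist a1 v) (G.dist b1 v) (distToSet G B v)
    (distToSet G A v) (G.dist y v) (by
      rcases Finset.mem_insert.1 hb with rfl | h
      · exact Or.inl rfl
      · exact Or.inr (Finset.inf_le h))
  have hins : ∀ (a : V) (S : Finset V), distToSet G (insert a S) v
      = min (G.dist a v : ℕ∞) (distToSet G S v) := fun a S => Finset.inf_insert
  have hsing : ∀ a : V, distToSet G {a} v = (G.dist a v : ℕ∞) := fun a => Finset.inf_singleton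
  rw [hins, hins, hins, hins, hsing, hsing]
  exact key

/-- Strategy-stealing invariant. -/
theorem steal_s2 {V : Type*} [Fintype V] [DecidableEq V] (G : SimpleGraph V) (a1 b1 : V) (k : ℕ) :
    ∀ (y : V) (A B : Finset V), b1 ∈ insert y B → y ∉ insert a1 B → y ∉ A →
    gameValue G k (insert a1 A) (insert y B) + replyValue G k (insert a1 B) A
      ≤ Fintype.card V + scoreA G {a1} {b1} := by
  induction k with
  | zero =>
    intro y A B hb hy1 hy2
    have h1 := replyValue_le G 0 (insert a1 B) A y hy1 hy2
    have h2 := score_bound G a1 b1 y A B hb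
    simp only [gameValue] at h1 ⊢
    linarith
  | succ k ih =>
    intro y A B hb hy1 hy2
    have hW := (replyValue_bounds_of G (k+1) (gameValue_bounds G (k+1)) (insert a1 B) A).2
    have hs := scoreA_nonneg G {a1} {b1}
    rw [← le_sub_iff_add_le, gameValue_succ]
    apply Real.sSup_le
    swap
    · linarith
    rintro r ⟨a, ha1, ha2, rfl⟩
    simp only [Finset.mem_insert, not_or] at ha1 ha2 hy1
    have hI := replyValue_le G (k+1) (insert a1 B) A a
      (by simp [ha1.1, ha2.2]) ha1.2
    rw [gameValue_succ] at hI
    obtain ⟨c, hc1, hc2, hc⟩ := sSup_mem_moves (fun c => c ∉ insert a1 B)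
      (fun c => c ∉ insert a A) (fun c => replyValue G k (insert c (insert a1 B)) (insert a A)) y
      (by simp [hy1]) (by simp [hy2, Ne.symm ha2.1])
    rw [hc] at hI
    simp only [Finset.mem_insert, not_or] at hc1 hc2
    by_cases hcy : c = y
    · subst hcy
      by_cases hex : ∃ z, z ∉ insert a (insert a1 A) ∧ z ∉ insert c B
      · obtain ⟨z, hz1, hz2⟩ := hex
        have h1 := replyValue_le G k (insert a (insert a1 A)) (insert c B) z hz1 hz2
        simp only [Finset.mem_insert, not_or] at hz1 hz2
        have h2 := ih z (insert a A) (insert c B) (Finset.mem_insert_of_mem hb)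
          (by simp [hz1, hz2]) (by simp [hz1])
        rw [Finset.insert_comm a1 a A, Finset.insert_comm a1 c B] at h2
        linarith
      · have : {s : ℝ | ∃ b, b ∉ insert a (insert a1 A) ∧ b ∉ insert c B ∧
            s = gameValue G k (insert a (insert a1 A)) (insert b (insert c B))} = ∅ := by
          ext s
          simp only [Set.mem_ofPred_eq, Set.mem_empty_iff_false, iff_false]
          rintro ⟨b, h1, h2, -⟩
          exact hex ⟨b, h1, h2⟩
        rw [replyValue, this, Real.sInf_empty]
        linarith
    · have h1 := replyValue_le G k (insert a (insert a1 A)) (insert y B) c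
        (by simp [hc1, hc2]) (by simp [hc1, hcy])
      have h2 := ih y (insert a A) (insert c B)
        (by
          simp only [Finset.mem_insert] at hb ⊢
          tauto)
        (by simp [hy1, Ne.symm hcy]) (by simp [hy2, Ne.symm ha2.1])
      rw [Finset.insert_comm a1 a A, Finset.insert_comm a1 c B, Finset.insert_comm y c B] at h2
      linarith

/-- For every finite connected graph `G` and every integer `t ≥ 1` with
`2t ≤ |V(G)|`, one has `VR(G, t) ≤ (1/2)·(VR(G, 1) + 1)`. -/
theorem vr_general_upper_bound {V : Type*} [Fintype V] [DecidableEq V]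
    (G : SimpleGraph V) (hG : G.Connected) (t : ℕ) (ht : 1 ≤ t)
    (h2t : 2 * t ≤ Fintype.card V) :
    VR G t ≤ (1 / 2 : ℝ) * (VR G 1 + 1) := by
  obtain ⟨k, rfl⟩ : ∃ k, t = k + 1 := ⟨t - 1, by omega⟩
  have hcard : 1 < Fintype.card V := by omega
  obtain ⟨u, _, -⟩ := Fintype.one_lt_card_iff.1 hcard
  obtain ⟨a1, -, -, hV⟩ := sSup_mem_moves (fun c => c ∉ (∅ : Finset V))
      (fun c => c ∉ (∅ : Finset V)) (fun c => replyValue G k (insert c ∅) ∅) u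
      (by simp) (by simp)
  obtain ⟨b, hb⟩ := Fintype.exists_ne_of_one_lt_card hcard a1
  obtain ⟨b1, hb1, -, hs⟩ := sInf_mem_moves (fun c => c ∉ (insert a1 ∅ : Finset V))
      (fun c => c ∉ (∅ : Finset V)) (fun c => gameValue G 0 (insert a1 ∅) (insert c ∅)) b
      (by simpa using hb) (by simp)
  have h1 : scoreA G {a1} {b1} ≤ gameValue G 1 ∅ ∅ := by
    have : replyValue G 0 (insert a1 ∅) ∅ ≤ gameValue G (0+1) ∅ ∅ := by
      rw [gameValue_succ]
      exact le_csSup (finite_moves _ _ _).bddAbove ⟨a1, by simp, by simp, rfl⟩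
    rw [replyValue, hs] at this
    simpa [gameValue] using this
  have h2 := replyValue_le G k (insert a1 ∅) ∅ b1 hb1 (by simp)
  have h3 := steal_s2 G a1 b1 k b1 ∅ ∅ (by simp) hb1 (by simp)
  have h4 : gameValue G (k+1) ∅ ∅ = replyValue G k (insert a1 ∅) ∅ := by
    rw [gameValue_succ, hV]
  have hn : (0 : ℝ) < Fintype.card V := by
    have : 0 < Fintype.card V := by omega
    exact_mod_cast this
  unfold VR
  rw [div_le_iff₀ hn]
  have : (1 / 2 : ℝ) * (gameValue G 1 ∅ ∅ / (Fintype.card V) + 1) * (Fintype.card V)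
      = (1 / 2 : ℝ) * (gameValue G 1 ∅ ∅ + Fintype.card V) := by
    field_simp
  rw [this]
  linarith
end

section
/- Let T be a finite tree with n vertices. Then either (C1) there exists a vertex c such that every connected component of T − c has at most n/3 vertices, or there exist two distinct vertices u and v such that (C2) every connected component of T − {u, v} has at most n/3 vertices, and (C2') after removing all edges on the path from u to v, the component containing u and the component containing v each contain more than n/3 vertices. -/
open SimpleGraph

namespace TreeSplit

variable {V : Type*} [Fintype V] [DecidableEq V] {T : SimpleGraph V}

/-- A choice of all the unique paths of a tree. -/
structure PathSys (T : SimpleGraph V) where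
  P : ∀ x y : V, T.Walk x y
  isPath : ∀ x y, (P x y).IsPath
  uniq : ∀ {x y} (p : T.Walk x y), p.IsPath → p = P x y

/-- Vertices separated from `v` by `u` (including `u`). -/
def PathSys.A (S : PathSys T) (u v : V) : Finset V :=
  Finset.univ.filter fun x => u ∈ (S.P v x).support

lemma PathSys.mem_A (S : PathSys T) {u v x : V} : x ∈ S.A u v ↔ u ∈ (S.P v x).support := by
  simp [PathSys.A]

lemma PathSys.rev (S : PathSys T) (x y : V) : (S.P x y).reverse = S.P y x :=
  S.uniq _ (S.isPath x y).reverse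

lemma PathSys.mem_comm (S : PathSys T) {a x y : V} :
    a ∈ (S.P x y).support ↔ a ∈ (S.P y x).support := by
  rw [← S.rev x y]; simp

lemma PathSys.nil (S : PathSys T) (x : V) : S.P x x = Walk.nil :=
  (S.uniq _ Walk.IsPath.nil).symm

lemma PathSys.adj (S : PathSys T) {x y : V} (h : T.Adj x y) : S.P x y = Walk.cons h Walk.nil := by
  refine (S.uniq _ ?_).symm
  simp [h.ne]

lemma PathSys.split (S : PathSys T) {u v x : V} (h : u ∈ (S.P v x).support) :
    S.P v x = (S.P v u).append (S.P u x) := by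
  conv_lhs => rw [← Walk.take_spec _ h]
  rw [S.uniq _ ((S.isPath v x).takeUntil h), S.uniq _ ((S.isPath v x).dropUntil h)]

lemma PathSys.dich (S : PathSys T) {x y : V} (h : T.Adj x y) (v : V) :
    S.P x v = Walk.cons h (S.P y v) ∨ S.P y v = Walk.cons h.symm (S.P x v) := by
  by_cases hx : x ∈ (S.P y v).support
  · right
    rw [S.split hx, S.adj h.symm]; rfl
  · left
    refine (S.uniq _ ?_).symm
    rw [Walk.cons_isPath_iff]
    exact ⟨S.isPath _ _, hx⟩

lemma PathSys.inter (S : PathSys T) {u v x a : V} (h : u ∈ (S.P v x).support)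
    (h1 : a ∈ (S.P v u).support) (h2 : a ∈ (S.P u x).support) : a = u := by
  have hp := S.isPath v x
  rw [S.split h] at hp
  by_contra hne
  exact hp.ne_of_mem_support_of_append hne h1 h2 rfl

lemma PathSys.disj (S : PathSys T) {u v : V} (h : u ≠ v) : Disjoint (S.A u v) (S.A v u) := by
  rw [Finset.disjoint_left]
  intro x h1 h2
  rw [S.mem_A] at h1 h2
  exact h (S.inter h1 (Walk.start_mem_support _) h2).symm

lemma PathSys.step (S : PathSys T) {u v x y : V} (hy : y ∈ S.A u v) (hne : y ≠ u)
    (h : T.Adj x y) : x ∈ S.A u v := by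
  rw [S.mem_A, S.mem_comm] at *
  rcases S.dich h v with h' | h'
  · rw [h']; simp [hy]
  · rw [h'] at hy
    simpa [hne.symm] using hy

lemma PathSys.edge (S : PathSys T) {d u x y : V} (hdu : T.Adj u d) (hx : x ∈ S.A d u)
    (hy : y ∉ S.A d u) (h : T.Adj x y) : x = d ∧ y = u := by
  have hxd : x = d := by
    by_contra hne
    exact hy (S.step hx hne h.symm)
  subst hxd
  refine ⟨rfl, ?_⟩
  rw [S.mem_A, S.mem_comm] at hy
  rcases S.dich h u with h' | h'
  · rw [S.adj hdu.symm] at h'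
    have := congrArg Walk.support h'
    simp at this
    have h2 := Walk.start_mem_support (S.P y u)
    rw [← this] at h2
    simpa using h2
  · rw [h'] at hy; simp at hy

lemma PathSys.cut (S : PathSys T) {d u x v : V} (hdu : T.Adj u d) (hx : x ∈ S.A d u)
    (hv : v ∉ S.A d u) : d ∈ (S.P v x).support := by
  rw [S.mem_comm]
  obtain ⟨e, he, h1, h2⟩ := (S.P x v).exists_boundary_dart (S.A d u : Set V) hx hv
  have := S.edge hdu h1 h2 e.adj
  rw [← this.1]
  exact Walk.dart_fst_mem_support_of_mem_darts _ he

/-- First step towards `w`. -/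
lemma PathSys.first (S : PathSys T) {c w : V} (h : w ≠ c) : ∃ d, T.Adj c d ∧ w ∈ S.A d c := by
  cases hp : S.P c w with
  | nil => exact absurd rfl h
  | @cons _ d _ hadj q =>
    refine ⟨d, hadj, ?_⟩
    rw [S.mem_A, hp]
    simp

lemma comp_le {K : Set V} (w : K) (B : Finset V) (hw : (w : V) ∈ B)
    (hB : ∀ x ∈ B, ∀ y ∈ K, T.Adj x y → y ∈ B) :
    Nat.card ((T.induce K).connectedComponentMk w).supp ≤ B.card := by
  have key : ∀ {a b : K} (p : (T.induce K).Walk a b), (a : V) ∈ B → (b : V) ∈ B := by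
    intro a b p
    induction p with
    | nil => exact id
    | @cons a b c h p ih =>
      intro ha
      exact ih (hB _ ha _ b.2 h)
  have : ∀ x ∈ ((T.induce K).connectedComponentMk w).supp, (x : V) ∈ B := by
    intro x hx
    rw [ConnectedComponent.mem_supp_iff, ConnectedComponent.eq] at hx
    obtain ⟨p⟩ := hx
    exact key p.reverse hw
  rw [← Nat.card_eq_finsetCard B]
  refine Nat.card_le_card_of_injective (fun x => (⟨x.1.1, this x.1 x.2⟩ : B)) ?_
  intro x y hxy
  apply Subtype.ext
  apply Subtype.ext
  simpa using hxy

lemma PathSys.le_comp (S : PathSys T) (u v : V) (E : Set (Sym2 V))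
    (hE : ∀ e ∈ E, e ∈ (S.P v u).edges) :
    (S.A u v).card ≤ Nat.card ((T.deleteEdges E).connectedComponentMk u).supp := by
  have : ∀ x ∈ S.A u v, x ∈ ((T.deleteEdges E).connectedComponentMk u).supp := by
    intro x hx
    rw [S.mem_A] at hx
    have hp := (S.isPath v x).isTrail.edges_nodup
    rw [S.split hx, Walk.edges_append, List.nodup_append] at hp
    rw [ConnectedComponent.mem_supp_iff, ConnectedComponent.eq]
    refine ⟨((S.P u x).toDeleteEdges E ?_).reverse⟩
    intro e he heE
    exact hp.2.2 e (hE e heE) e he rfl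
  rw [← Nat.card_eq_finsetCard (S.A u v)]
  refine Nat.card_le_card_of_injective (fun x : S.A u v => ⟨x.1, this x.1 x.2⟩) ?_
  intro x y hxy
  apply Subtype.ext
  simpa using hxy

lemma PathSys.extend (S : PathSys T) {u v w d : V} (huv : u ≠ v) (hw : w ∈ S.A u v)
    (hd : T.Adj u d) (hwd : w ∈ S.A d u) :
    d ≠ v ∧ S.A d u ⊆ S.A d v ∧ S.A v u ⊆ S.A v d ∧
      (S.P d v).length = (S.P u v).length + 1 := by
  have hv : v ∉ S.A d u := by
    intro hv
    rw [S.mem_A] at *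
    exact hd.ne (S.inter hw (S.mem_comm.1 hv) hwd).symm
  have hP : S.P d v = Walk.cons hd.symm (S.P u v) := by
    rcases S.dich hd v with h | h
    · exfalso; apply hv; rw [S.mem_A, h]; simp
    · exact h
  refine ⟨?_, ?_, ?_, by rw [hP]; simp⟩
  · rintro rfl
    apply hv; rw [S.mem_A]; simp
  · intro x hx
    rw [S.mem_A]
    exact S.cut hd hx hv
  · intro x hx
    rw [S.mem_A] at *
    rcases S.dich hd x with h | h
    · rw [h] at hx
      simpa [huv.symm] using hx
    · rw [h]; simp [hx]

end TreeSplit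

open TreeSplit

/-- In a finite tree `T` on `n` vertices, either there is a vertex `c` all of
whose components of `T − c` have at most `n/3` vertices, or there are two distinct vertices
`u, v` such that all components of `T − {u,v}` have at most `n/3` vertices, while after
removing the edges of the `u`–`v` path, the components of `u` and of `v` each have more
than `n/3` vertices. -/
theorem tree_one_or_two_splitting_vertices {V : Type*} [Fintype V] [DecidableEq V]
    (T : SimpleGraph V) (hconn : T.Connected) (hacyc : T.IsAcyclic)
    (n : ℕ) (hn : n = Fintype.card V) :
    (∃ c : V, ∀ w : ↥{x : V | x ≠ c},
        3 * Nat.card ((T.induce {x : V | x ≠ c}).connectedComponentMk w).supp ≤ n) ∨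
    (∃ u v : V, u ≠ v ∧
      (∀ w : ↥{x : V | x ≠ u ∧ x ≠ v},
          3 * Nat.card
            ((T.induce {x : V | x ≠ u ∧ x ≠ v}).connectedComponentMk w).supp ≤ n) ∧
      (n < 3 * Nat.card
          ((T.deleteEdges
            {e | ∃ p : T.Walk u v, p.IsPath ∧ e ∈ p.edges}).connectedComponentMk u).supp) ∧
      (n < 3 * Nat.card
          ((T.deleteEdges
            {e | ∃ p : T.Walk u v, p.IsPath ∧ e ∈ p.edges}).connectedComponentMk v).supp)) := by
  classical
  have hex : ∀ x y : V, ∃ p : T.Walk x y, p.IsPath := fun x y => by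
    obtain ⟨p⟩ := hconn.preconnected x y
    exact ⟨p.bypass, p.bypass_isPath⟩
  choose P hP using hex
  let S : PathSys T := ⟨P, hP, fun {x y} p hp =>
    congrArg Subtype.val (hacyc.path_unique ⟨p, hp⟩ ⟨P x y, hP x y⟩)⟩
  by_cases hpair : ∃ u v : V, u ≠ v ∧ n < 3 * (S.A u v).card ∧ n < 3 * (S.A v u).card
  · right
    let F : Finset (V × V) := Finset.univ.filter fun q =>
      q.1 ≠ q.2 ∧ n < 3 * (S.A q.1 q.2).card ∧ n < 3 * (S.A q.2 q.1).card
    have hF : F.Nonempty := by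
      obtain ⟨u, v, h⟩ := hpair
      exact ⟨(u, v), by simpa [F] using h⟩
    obtain ⟨⟨u, v⟩, hm, hmax⟩ := F.exists_max_image (fun q => (S.P q.1 q.2).length) hF
    have hm' : u ≠ v ∧ n < 3 * (S.A u v).card ∧ n < 3 * (S.A v u).card := by
      simpa [F] using hm
    obtain ⟨huv, hu, hv⟩ := hm'
    have hmax' : ∀ a b : V, a ≠ b → n < 3 * (S.A a b).card → n < 3 * (S.A b a).card →
        (S.P a b).length ≤ (S.P u v).length := by
      intro a b h1 h2 h3
      exact hmax (a, b) (by simpa [F] using ⟨h1, h2, h3⟩)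
    have hlen : (S.P v u).length = (S.P u v).length := by
      rw [← S.rev u v]; simp
    refine ⟨u, v, huv, ?_, ?_, ?_⟩
    · rintro ⟨w, hwu, hwv⟩
      by_cases h1 : w ∈ S.A u v
      · obtain ⟨d, hd, hwd⟩ := S.first hwu
        obtain ⟨e1, e2, e3, e4⟩ := S.extend huv h1 hd hwd
        have hle : 3 * (S.A d u).card ≤ n := by
          by_contra hlt
          have := Finset.card_le_card e2
          have := Finset.card_le_card e3
          have := hmax' d v e1 (by omega) (by omega)
          omega
        refine le_trans (Nat.mul_le_mul_left 3 (comp_le _ (S.A d u) hwd ?_)) hle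
        intro x hx y hy hxy
        by_contra hyn
        exact hy.1 (S.edge hd hx hyn hxy).2
      by_cases h2 : w ∈ S.A v u
      · obtain ⟨d, hd, hwd⟩ := S.first hwv
        obtain ⟨e1, e2, e3, e4⟩ := S.extend huv.symm h2 hd hwd
        have hle : 3 * (S.A d v).card ≤ n := by
          by_contra hlt
          have := Finset.card_le_card e2
          have := Finset.card_le_card e3
          have := hmax' d u e1 (by omega) (by omega)
          omega
        refine le_trans (Nat.mul_le_mul_left 3 (comp_le _ (S.A d v) hwd ?_)) hle
        intro x hx y hy hxy
        by_contra hyn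
        exact hy.2 (S.edge hd hx hyn hxy).2
      · have hc := comp_le (T := T) (K := {x : V | x ≠ u ∧ x ≠ v}) ⟨w, hwu, hwv⟩
          (S.A u v ∪ S.A v u)ᶜ (by simp [h1, h2]) (by
            intro x hx y hy hxy
            simp only [Finset.mem_compl, Finset.mem_union, not_or] at hx ⊢
            exact ⟨fun h => hx.1 (S.step h hy.1 hxy), fun h => hx.2 (S.step h hy.2 hxy)⟩)
        rw [Finset.card_compl, Finset.card_union_of_disjoint (S.disj huv)] at hc
        omega
    · refine lt_of_lt_of_le hu (Nat.mul_le_mul_left 3 (S.le_comp u v _ ?_))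
      rintro e ⟨p, hp, he⟩
      rw [S.uniq p hp, ← S.rev v u] at he
      simpa using he
    · refine lt_of_lt_of_le hv (Nat.mul_le_mul_left 3 (S.le_comp v u _ ?_))
      rintro e ⟨p, hp, he⟩
      rw [S.uniq p hp] at he
      exact he
  · left
    by_contra hno
    have hstep : ∀ c : V, ∃ d, T.Adj c d ∧ n < 3 * (S.A d c).card := by
      intro c
      by_contra hc
      push Not at hc
      apply hno
      refine ⟨c, ?_⟩
      rintro ⟨w, hw⟩
      obtain ⟨d, hd, hwd⟩ := S.first hw
      refine le_trans (Nat.mul_le_mul_left 3 (comp_le _ (S.A d c) hwd ?_)) (hc d hd)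
      intro x hx y hy hxy
      by_contra hyn
      exact hy (S.edge hd hx hyn hxy).2
    let F : Finset (V × V) := Finset.univ.filter fun q =>
      T.Adj q.1 q.2 ∧ n < 3 * (S.A q.2 q.1).card
    have hF : F.Nonempty := by
      obtain ⟨c⟩ := hconn.nonempty
      obtain ⟨d, h⟩ := hstep c
      exact ⟨(c, d), by simpa [F] using h⟩
    obtain ⟨⟨c, d⟩, hm, hmin⟩ := F.exists_min_image (fun q => (S.A q.2 q.1).card) hF
    have hm' : T.Adj c d ∧ n < 3 * (S.A d c).card := by simpa [F] using hm
    obtain ⟨hcd, hbig⟩ := hm'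
    obtain ⟨e, hde, hbe⟩ := hstep d
    have hec : e ≠ c := by
      rintro rfl
      exact hpair ⟨d, e, hcd.ne.symm, hbig, hbe⟩
    have hle := hmin (d, e) (by simpa [F] using ⟨hde, hbe⟩)
    have hlt : (S.A e d).card < (S.A d c).card := by
      apply Finset.card_lt_card
      rw [Finset.ssubset_iff_of_subset]
      · refine ⟨d, ?_, ?_⟩
        · rw [S.mem_A]; simp
        · rw [S.mem_A, S.nil]; simpa using hde.ne.symm
      · intro x hx
        have hc : c ∉ S.A e d := by
          rw [S.mem_A, S.adj hcd.symm]
          simp [hec, hde.ne.symm]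
        rw [S.mem_A] at hx ⊢
        rcases S.dich hcd x with h | h
        · rw [h]; simp
        · exfalso
          rcases S.dich hde x with h' | h'
          · rw [h] at h'
            have := congrArg Walk.snd h'
            simp at this
            exact hec this.symm
          · have hp := S.isPath e x
            rw [h', Walk.cons_isPath_iff] at hp
            exact hp.2 hx
    exact absurd hle (not_le.2 hlt)
end

section
/- For every finite tree T with at least 4 vertices, VR(T, 2) > 1/3. -/
open SimpleGraph

variable {V : Type*}

section Helpers

lemma distToSet_lt (G : SimpleGraph V) {A B : Finset V} {z : V}
    (h : ∃ a ∈ A, ∀ b ∈ B, G.dist a z < G.dist b z) :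
    distToSet G A z < distToSet G B z := by
  obtain ⟨a, ha, h⟩ := h
  unfold distToSet
  refine lt_of_le_of_lt (Finset.inf_le ha) ?_
  rw [Finset.lt_inf_iff (WithTop.coe_lt_top _)]
  intro b hb
  exact_mod_cast h b hb

lemma distToSet_le (G : SimpleGraph V) {A B : Finset V} {z : V}
    (h : ∃ a ∈ A, ∀ b ∈ B, G.dist a z ≤ G.dist b z) :
    distToSet G A z ≤ distToSet G B z := by
  obtain ⟨a, ha, h⟩ := h
  unfold distToSet
  refine le_trans (Finset.inf_le ha) ?_
  refine Finset.le_inf ?_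
  intro b hb
  exact_mod_cast h b hb

lemma score_ge [Fintype V] (G : SimpleGraph V) {A B : Finset V} (W : Finset V)
    (h : ∀ z ∈ W, ∃ a ∈ A, ∀ b ∈ B, G.dist a z < G.dist b z) :
    (W.card : ℝ) ≤ scoreA G A B := by
  classical
  unfold scoreA
  have : (W.card : ℝ) = ∑ v : V, if v ∈ W then (1 : ℝ) else 0 := by simp
  rw [this]
  refine Finset.sum_le_sum fun z _ => ?_
  by_cases hz : z ∈ W
  · simp [hz, distToSet_lt G (h z hz)]
  · simp only [hz, if_false]
    split_ifs <;> norm_num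

lemma score_ge_half [Fintype V] (G : SimpleGraph V) {A B : Finset V} (W : Finset V) (x : V)
    (hx : x ∉ W)
    (h : ∀ z ∈ W, ∃ a ∈ A, ∀ b ∈ B, G.dist a z < G.dist b z)
    (h2 : ∃ a ∈ A, ∀ b ∈ B, G.dist a x ≤ G.dist b x) :
    (W.card : ℝ) + 1 / 2 ≤ scoreA G A B := by
  classical
  unfold scoreA
  have : (W.card : ℝ) + 1 / 2 =
      ∑ v : V, ((if v ∈ W then (1 : ℝ) else 0) + if v = x then (1 / 2 : ℝ) else 0) := by
    rw [Finset.sum_add_distrib]; simp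
  rw [this]
  refine Finset.sum_le_sum fun z _ => ?_
  by_cases hz : z ∈ W
  · have : z ≠ x := by rintro rfl; exact hx hz
    simp [hz, this, distToSet_lt G (h z hz)]
  · by_cases hzx : z = x
    · subst hzx
      rcases (distToSet_le G h2).lt_or_eq with h3 | h3
      · simp only [hz, if_false, h3, if_true]; norm_num
      · simp only [hz, if_false, h3, lt_irrefl, if_true]; norm_num
    · simp only [hz, if_false, hzx]
      split_ifs <;> norm_num

lemma finite_b [Fintype V] (P : V → Prop) (f : V → ℝ) :
    {s : ℝ | ∃ b, P b ∧ s = f b}.Finite := by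
  refine (Set.finite_range f).subset ?_
  rintro s ⟨b, _, rfl⟩
  exact ⟨b, rfl⟩

lemma lt_gameValue_succ [Fintype V] [DecidableEq V] (G : SimpleGraph V) (t : ℕ)
    (A B : Finset V) (r : ℝ) (hc : A.card + B.card + 1 < Fintype.card V)
    (a : V) (ha : a ∉ A) (haB : a ∉ B)
    (h : ∀ b, b ∉ insert a A → b ∉ B → r < gameValue G t (insert a A) (insert b B)) :
    r < gameValue G (t + 1) A B := by
  rw [gameValue]
  set g : V → ℝ := fun a => sInf {s : ℝ | ∃ b, b ∉ insert a A ∧ b ∉ B ∧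
          s = gameValue G t (insert a A) (insert b B)} with hg
  have hbdd : BddAbove {r : ℝ | ∃ a, a ∉ A ∧ a ∉ B ∧ r = g a} := by
    have := (finite_b (fun a => a ∉ A ∧ a ∉ B) g).bddAbove
    simpa only [and_assoc] using this
  refine lt_of_lt_of_le ?_ (le_csSup hbdd ⟨a, ha, haB, rfl⟩)
  have hfin : {s : ℝ | ∃ b, b ∉ insert a A ∧ b ∉ B ∧
          s = gameValue G t (insert a A) (insert b B)}.Finite := by
    have := finite_b (fun b => b ∉ insert a A ∧ b ∉ B)
      (fun b => gameValue G t (insert a A) (insert b B))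
    simpa only [and_assoc] using this
  have hne : {s : ℝ | ∃ b, b ∉ insert a A ∧ b ∉ B ∧
          s = gameValue G t (insert a A) (insert b B)}.Nonempty := by
    have h1 : (insert a A ∪ B).card < Fintype.card V := by
      have := Finset.card_union_le (insert a A) B
      have := Finset.card_insert_le a A
      omega
    obtain ⟨b, hb⟩ : ∃ b, b ∉ insert a A ∪ B := by
      by_contra hcon
      push Not at hcon
      rw [Finset.eq_univ_iff_forall.2 hcon, Finset.card_univ] at h1
      omega
    rw [Finset.mem_union, not_or] at hb
    exact ⟨_, b, hb.1, hb.2, rfl⟩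
  obtain ⟨b, hb1, hb2, hb3⟩ := hne.csInf_mem hfin
  show r < sInf _
  rw [hb3]
  exact h b hb1 hb2

lemma strategy [Fintype V] [DecidableEq V] (T : SimpleGraph V) (h4 : 4 ≤ Fintype.card V)
    (a₁ : V) (h : ∀ b₁, b₁ ≠ a₁ → ∃ a₂, a₂ ≠ a₁ ∧ a₂ ≠ b₁ ∧
      ∀ b₂, b₂ ≠ a₁ → b₂ ≠ a₂ → b₂ ≠ b₁ →
      (Fintype.card V : ℝ) / 3 < scoreA T {a₂, a₁} {b₂, b₁}) :
    (1 / 3 : ℝ) < VR T 2 := by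
  unfold VR
  have hn : (0 : ℝ) < Fintype.card V := by
    have : 0 < Fintype.card V := by omega
    exact_mod_cast this
  rw [lt_div_iff₀ hn]
  have key : (Fintype.card V : ℝ) / 3 < gameValue T 2 ∅ ∅ := by
    refine lt_gameValue_succ T 1 ∅ ∅ _ (by simp; omega) a₁ (by simp) (by simp) ?_
    intro b₁ hb₁ _
    obtain ⟨a₂, h1, h2, h3⟩ := h b₁ (by simpa using hb₁)
    refine lt_gameValue_succ T 0 _ _ _ (by simp; omega) a₂ (by simpa using h1)
      (by simpa using h2) ?_
    intro b₂ hb₂ hb₂'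
    simp only [Finset.mem_insert, not_or, Finset.notMem_empty, not_false_eq_true,
      and_true] at hb₂ hb₂'
    exact h3 b₂ hb₂.2 hb₂.1 hb₂'
  linarith

/-- The side of `y` after deleting the edge `xy`. -/
noncomputable def br [Fintype V] (T : SimpleGraph V) (x y : V) : Finset V :=
  Finset.univ.filter fun z => T.dist z y < T.dist z x

lemma mem_br [Fintype V] {T : SimpleGraph V} {x y z : V} :
    z ∈ br T x y ↔ T.dist z y < T.dist z x := by simp [br]

lemma reach_of_le {T : SimpleGraph V} (hc : T.Connected) {x y w : V} (hxy : T.Adj x y)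
    (h : T.dist w y ≤ T.dist w x) : (T.deleteEdges {s(x, y)}).Reachable w y := by
  classical
  obtain ⟨p, hp⟩ := hc.exists_walk_length_eq_dist w y
  have hx : x ∉ p.support := by
    intro hx
    have h1 := T.dist_le (p.takeUntil x hx)
    have h2 := congrArg Walk.length (p.take_spec hx)
    rw [Walk.length_append] at h2
    have h3 : 0 < (p.dropUntil x hx).length := by
      rcases Nat.eq_zero_or_pos (p.dropUntil x hx).length with h0 | h0
      · exact absurd (Walk.eq_of_length_eq_zero h0) hxy.ne
      · exact h0
    omega
  have he : s(x, y) ∉ p.edges := fun he => hx (p.fst_mem_support_of_mem_edges he)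
  exact ⟨p.toDeleteEdge s(x, y) he⟩

lemma not_reach {T : SimpleGraph V} (ha : T.IsAcyclic) {x y : V} (hxy : T.Adj x y) :
    ¬ (T.deleteEdges {s(x, y)}).Reachable x y := by
  have := (isAcyclic_iff_forall_adj_isBridge.1 ha) hxy
  simpa [isBridge_iff, deleteEdges] using this

lemma dist_ne {T : SimpleGraph V} (hc : T.Connected) (ha : T.IsAcyclic) {x y : V}
    (hxy : T.Adj x y) (w : V) : T.dist w x ≠ T.dist w y := by
  intro h
  have h1 := reach_of_le hc hxy h.ge
  have h2 := reach_of_le hc hxy.symm h.le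
  rw [Sym2.eq_swap] at h2
  exact not_reach ha hxy (h2.symm.trans h1)

lemma dist_adj {T : SimpleGraph V} (hc : T.Connected) {x y : V}
    (hxy : T.Adj x y) (w : V) : T.dist w x ≤ T.dist w y + 1 := by
  have := hc.dist_triangle (u := w) (v := y) (w := x)
  rw [dist_eq_one_iff_adj.2 hxy.symm] at this
  exact this

lemma dist_cross [Fintype V] {T : SimpleGraph V} (hc : T.Connected) (ha : T.IsAcyclic) {x y w z : V}
    (hxy : T.Adj x y) (hw : w ∈ br T x y) (hz : z ∉ br T x y) :
    T.dist w z = T.dist w y + 1 + T.dist x z := by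
  classical
  rw [mem_br] at hw hz
  obtain ⟨p, hp⟩ := hc.exists_walk_length_eq_dist w z
  have h1 := reach_of_le hc hxy hw.le
  have h2 := reach_of_le hc hxy.symm (not_lt.1 hz)
  rw [Sym2.eq_swap] at h2
  have he : s(x, y) ∈ p.edges := by
    by_contra he
    have h3 : (T.deleteEdges {s(x, y)}).Reachable w z := ⟨p.toDeleteEdge s(x, y) he⟩
    exact not_reach ha hxy (h2.symm.trans (h3.symm.trans h1))
  have hx := p.fst_mem_support_of_mem_edges he
  have h3 := T.dist_le (p.takeUntil x hx)
  have h4 := T.dist_le (p.dropUntil x hx)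
  have h5 := congrArg Walk.length (p.take_spec hx)
  rw [Walk.length_append] at h5
  have h6 := hc.dist_triangle (u := w) (v := x) (w := z)
  have h7 := dist_adj hc hxy w
  omega

lemma exists_br [Fintype V] {T : SimpleGraph V} (hc : T.Connected) {v b : V} (h : b ≠ v) :
    ∃ w, T.Adj v w ∧ b ∈ br T v w := by
  obtain ⟨p, hp⟩ := hc.exists_walk_length_eq_dist v b
  cases p with
  | nil => exact absurd rfl h
  | cons hadj p =>
    refine ⟨_, hadj, ?_⟩
    rw [mem_br, T.dist_comm (u := b), T.dist_comm (u := b)]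
    have := T.dist_le p
    rw [Walk.length_cons] at hp
    omega

section Tree

variable [Fintype V] {T : SimpleGraph V}

lemma self_mem_br {x y : V} (hxy : T.Adj x y) : y ∈ br T x y := by
  rw [mem_br, dist_self, dist_eq_one_iff_adj.2 hxy.symm]; omega

lemma notMem_br {x y : V} : x ∉ br T x y := by
  rw [mem_br, dist_self]; omega

lemma notMem_br_iff (hc : T.Connected) (ha : T.IsAcyclic) {x y z : V} (hxy : T.Adj x y) :
    z ∉ br T x y ↔ z ∈ br T y x := by
  have := dist_ne hc ha hxy z
  rw [mem_br, mem_br]; omega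

lemma br_sub (hc : T.Connected) (ha : T.IsAcyclic) {x v w : V} (hxv : T.Adj x v)
    (hvw : T.Adj v w) (hwx : w ≠ x) : br T v w ⊂ br T x v := by
  rw [Finset.ssubset_iff_of_subset]
  · exact ⟨v, self_mem_br hxv, notMem_br⟩
  · intro z hz
    by_contra hzx
    have hx : x ∉ br T v w := by
      rw [mem_br, dist_eq_one_iff_adj.2 hxv]
      have := hc.pos_dist_of_ne hwx.symm
      omega
    have h1 := dist_cross hc ha hvw hz hx
    rw [dist_eq_one_iff_adj.2 hxv.symm] at h1
    rw [mem_br] at hzx hz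
    have h2 := dist_adj hc hvw z
    omega

/-- `x` strictly separates `b` from `z`. -/
lemma sep_lt (hc : T.Connected) (ha : T.IsAcyclic) {v w b z : V} (hvw : T.Adj v w)
    (hb : b ∈ br T v w) (hz : z ∉ br T v w) : T.dist v z < T.dist b z := by
  rw [dist_cross hc ha hvw hb hz]; omega

lemma sep_lt' (hc : T.Connected) (ha : T.IsAcyclic) {x v b z : V} (hxv : T.Adj x v)
    (hb : b ∉ br T x v) (hz : z ∈ br T x v) : T.dist v z < T.dist b z := by
  rw [T.dist_comm (u := b), dist_cross hc ha hxv hz hb, T.dist_comm (u := v)]; omega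

/-- A branch of size at least `n/3` containing no smaller such branch. -/
def Good (T : SimpleGraph V) (x v : V) : Prop :=
  T.Adj x v ∧ Fintype.card V ≤ 3 * (br T x v).card ∧
    ∀ w, T.Adj v w → w ≠ x → 3 * (br T v w).card < Fintype.card V

lemma exists_good (hc : T.Connected) (ha : T.IsAcyclic) {p q : V} (hpq : T.Adj p q)
    (h : Fintype.card V ≤ 3 * (br T p q).card) :
    ∃ x v, Good T x v ∧ br T x v ⊆ br T p q := by
  induction hk : (br T p q).card using Nat.strong_induction_on generalizing p q with
  | _ k ih =>
    by_cases hg : Good T p q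
    · exact ⟨p, q, hg, subset_rfl⟩
    · unfold Good at hg
      push Not at hg
      obtain ⟨w, hw, hwp, hcard⟩ := hg hpq h
      have hs := br_sub hc ha hpq hw hwp
      obtain ⟨x, v, h1, h2⟩ := ih _ (hk ▸ Finset.card_lt_card hs) hw hcard rfl
      exact ⟨x, v, h1, h2.trans hs.subset⟩

/-- One-vertex case. -/
lemma case_center [DecidableEq V] (hc : T.Connected) (ha : T.IsAcyclic)
    (h4 : 4 ≤ Fintype.card V) (c : V)
    (h : ∀ w, T.Adj c w → 3 * (br T c w).card < Fintype.card V) :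
    (1 / 3 : ℝ) < VR T 2 := by
  refine strategy T h4 c fun b₁ hb₁ => ?_
  obtain ⟨a₂, ha₂⟩ : ∃ a, a ∉ ({c, b₁} : Finset V) := by
    by_contra hcon
    push Not at hcon
    have h1 := Finset.card_le_two (a := c) (b := b₁)
    rw [Finset.eq_univ_iff_forall.2 hcon, Finset.card_univ] at h1
    omega
  simp only [Finset.mem_insert, Finset.mem_singleton, not_or] at ha₂
  refine ⟨a₂, ha₂.1, ha₂.2, fun b₂ hb₂ _ _ => ?_⟩
  obtain ⟨w₁, hw₁, hm₁⟩ := exists_br hc hb₁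
  obtain ⟨w₂, hw₂, hm₂⟩ := exists_br hc hb₂
  have hs := score_ge T (A := {a₂, c}) (B := {b₂, b₁}) (br T c w₁ ∪ br T c w₂)ᶜ (by
    intro z hz
    simp only [Finset.mem_compl, Finset.mem_union, not_or] at hz
    refine ⟨c, by simp, ?_⟩
    intro b hb
    simp only [Finset.mem_insert, Finset.mem_singleton] at hb
    rcases hb with rfl | rfl
    · exact sep_lt hc ha hw₂ hm₂ hz.2
    · exact sep_lt hc ha hw₁ hm₁ hz.1)
  refine lt_of_lt_of_le ?_ hs
  have e1 := Finset.card_add_card_compl (br T c w₁ ∪ br T c w₂)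
  have e2 := Finset.card_union_le (br T c w₁) (br T c w₂)
  have e3 := h w₁ hw₁
  have e4 := h w₂ hw₂
  have : Fintype.card V < 3 * (br T c w₁ ∪ br T c w₂)ᶜ.card := by omega
  have : (Fintype.card V : ℝ) < 3 * ((br T c w₁ ∪ br T c w₂)ᶜ.card : ℝ) := by exact_mod_cast this
  linarith

/-- Region of a vertex `b` when A holds `u` and `v`. -/
lemma exists_region [DecidableEq V] (hc : T.Connected) (ha : T.IsAcyclic) {x v y u : V}
    (hv : Good T x v) (hu : Good T y u) {b : V} (hbv : b ≠ v) (hbu : b ≠ u) :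
    ∃ C : Finset V, (C = (br T x v ∪ br T y u)ᶜ ∨ 3 * C.card < Fintype.card V) ∧
      ∀ z, z ∉ C → T.dist v z < T.dist b z ∨ T.dist u z < T.dist b z := by
  by_cases h1 : b ∈ br T x v
  · obtain ⟨w, hw, hm⟩ := exists_br hc hbv
    have hwx : w ≠ x := by
      rintro rfl
      rw [mem_br] at h1 hm
      omega
    exact ⟨br T v w, Or.inr (hv.2.2 w hw hwx), fun z hz => Or.inl (sep_lt hc ha hw hm hz)⟩
  by_cases h2 : b ∈ br T y u
  · obtain ⟨w, hw, hm⟩ := exists_br hc hbu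
    have hwx : w ≠ y := by
      rintro rfl
      rw [mem_br] at h2 hm
      omega
    exact ⟨br T u w, Or.inr (hu.2.2 w hw hwx), fun z hz => Or.inr (sep_lt hc ha hw hm hz)⟩
  refine ⟨_, Or.inl rfl, fun z hz => ?_⟩
  simp only [Finset.mem_compl, not_not, Finset.mem_union] at hz
  rcases hz with hz | hz
  · exact Or.inl (sep_lt' hc ha hv.1 h1 hz)
  · exact Or.inr (sep_lt' hc ha hu.1 h2 hz)

/-- A starts at `v`. `V1`, `U1` are heaviest child branch sizes. -/
lemma case_pair [DecidableEq V] (hc : T.Connected) (ha : T.IsAcyclic)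
    (h4 : 4 ≤ Fintype.card V) {x v y u u' : V} (V1 : ℕ)
    (hv : Good T x v) (hu : Good T y u) (hd : Disjoint (br T x v) (br T y u))
    (hV1 : ∀ w, T.Adj v w → w ≠ x → (br T v w).card ≤ V1)
    (hu' : T.Adj u u') (huy : u' ≠ y)
    (h : Fintype.card V + 3 * V1 < 3 * ((br T u u').card + (br T x v).card) ∨
      (Fintype.card V + 3 * V1 ≤ 3 * ((br T u u').card + (br T x v).card) ∧ x ∉ br T y u)) :
    (1 / 3 : ℝ) < VR T 2 := by
  have hvV := self_mem_br hv.1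
  have huU := self_mem_br hu.1
  have huV : u ∉ br T x v := Finset.disjoint_right.1 hd huU
  have hvU : v ∉ br T y u := Finset.disjoint_left.1 hd hvV
  have huv : u ≠ v := by rintro rfl; exact huV hvV
  have hU1 := br_sub hc ha hu.1 hu' huy
  have hu'U : u' ∈ br T y u := hU1.subset (self_mem_br hu')
  have hu'V : u' ∉ br T x v := Finset.disjoint_right.1 hd hu'U
  refine strategy T h4 v fun b₁ hb₁ => ?_
  by_cases hb : b₁ = u
  swap
  · refine ⟨u, huv, fun h => hb h.symm, fun b₂ h1 h2 _ => ?_⟩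
    obtain ⟨C₁, hC₁, hm₁⟩ := exists_region hc ha hv hu hb₁ hb
    obtain ⟨C₂, hC₂, hm₂⟩ := exists_region hc ha hv hu h1 h2
    have hs := score_ge T (A := {u, v}) (B := {b₂, b₁}) (C₁ ∪ C₂)ᶜ (by
      intro z hz
      simp only [Finset.mem_compl, Finset.mem_union, not_or] at hz
      rcases le_total (T.dist v z) (T.dist u z) with hle | hle
      · refine ⟨v, by simp, ?_⟩
        intro b hb
        simp only [Finset.mem_insert, Finset.mem_singleton] at hb
        rcases hb with rfl | rfl
        · have := hm₂ z hz.2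
          omega
        · have := hm₁ z hz.1
          omega
      · refine ⟨u, by simp, ?_⟩
        intro b hb
        simp only [Finset.mem_insert, Finset.mem_singleton] at hb
        rcases hb with rfl | rfl
        · have := hm₂ z hz.2
          omega
        · have := hm₁ z hz.1
          omega)
    refine lt_of_lt_of_le ?_ hs
    have e1 := Finset.card_add_card_compl (C₁ ∪ C₂)
    have e2 := Finset.card_union_le C₁ C₂
    have e3 := Finset.card_add_card_compl (br T x v ∪ br T y u)
    have e4 := Finset.card_union_of_disjoint hd
    have e5 := hv.2.1
    have e6 := hu.2.1
    have : Fintype.card V < 3 * (C₁ ∪ C₂)ᶜ.card := by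
      rcases hC₁ with hC₁ | hC₁ <;> rcases hC₂ with hC₂ | hC₂
      · rw [hC₁, hC₂, Finset.union_self] at e1 ⊢
        omega
      · rw [← hC₁] at e3
        omega
      · rw [← hC₂] at e3
        omega
      · omega
    have : (Fintype.card V : ℝ) < 3 * ((C₁ ∪ C₂)ᶜ.card : ℝ) := by exact_mod_cast this
    linarith
  subst hb
  refine ⟨u', fun h => hu'V (h ▸ hvV), hu'.ne', fun b₂ h1 h2 h3 => ?_⟩
  by_cases hb₂ : b₂ ∈ br T x v
  swap
  · have hs := score_ge T (A := {u', v}) (B := {b₂, b₁}) (insert u' (br T x v)) (by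
      intro z hz
      rw [Finset.mem_insert] at hz
      rcases hz with rfl | hz
      · refine ⟨z, by simp, ?_⟩
        intro b hb
        simp only [Finset.mem_insert, Finset.mem_singleton] at hb
        rw [dist_self]
        rcases hb with rfl | rfl
        · exact hc.pos_dist_of_ne h2
        · exact hc.pos_dist_of_ne hu'.ne
      · refine ⟨v, by simp, ?_⟩
        intro b hb
        simp only [Finset.mem_insert, Finset.mem_singleton] at hb
        rcases hb with rfl | rfl
        · exact sep_lt' hc ha hv.1 hb₂ hz
        · exact sep_lt' hc ha hv.1 huV hz)
    rw [Finset.card_insert_of_notMem hu'V] at hs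
    push_cast at hs
    have : (Fintype.card V : ℝ) ≤ 3 * ((br T x v).card : ℝ) := by exact_mod_cast hv.2.1
    linarith
  obtain ⟨w, hw, hm⟩ := exists_br hc h1
  have hwx : w ≠ x := by
    rintro rfl
    rw [mem_br] at hb₂ hm
    omega
  have hsub := br_sub hc ha hv.1 hw hwx
  have hb₂U : b₂ ∉ br T y b₁ := Finset.disjoint_left.1 hd hb₂
  have hwin : ∀ z ∈ (br T x v \ br T v w) ∪ br T b₁ u',
      ∃ a ∈ ({u', v} : Finset V), ∀ b ∈ ({b₂, b₁} : Finset V), T.dist a z < T.dist b z := by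
    intro z hz
    rw [Finset.mem_union, Finset.mem_sdiff] at hz
    rcases hz with hz | hz
    · refine ⟨v, by simp, ?_⟩
      intro b hb
      simp only [Finset.mem_insert, Finset.mem_singleton] at hb
      rcases hb with rfl | rfl
      · exact sep_lt hc ha hw hm hz.2
      · exact sep_lt' hc ha hv.1 huV hz.1
    · refine ⟨u', by simp, ?_⟩
      intro b hb
      simp only [Finset.mem_insert, Finset.mem_singleton] at hb
      rcases hb with rfl | rfl
      · exact sep_lt' hc ha hu' (fun hh => hb₂U (hU1.subset hh)) hz
      · exact sep_lt' hc ha hu' notMem_br hz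
  have hdis : Disjoint (br T x v \ br T v w) (br T b₁ u') :=
    (hd.mono_left Finset.sdiff_subset).mono_right hU1.subset
  have e1 := Finset.card_union_of_disjoint hdis
  have e2 := Finset.card_sdiff_add_card_eq_card hsub.subset
  have e3 := hV1 w hw hwx
  rcases h with h | ⟨h, hxU⟩
  · refine lt_of_lt_of_le ?_ (score_ge T _ hwin)
    have : Fintype.card V < 3 * ((br T x v \ br T v w) ∪ br T b₁ u').card := by omega
    have : (Fintype.card V : ℝ) < 3 * (((br T x v \ br T v w) ∪ br T b₁ u').card : ℝ) := by
      exact_mod_cast this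
    linarith
  · have hxn : x ∉ (br T x v \ br T v w) ∪ br T b₁ u' := by
      rw [Finset.mem_union, Finset.mem_sdiff]
      rintro (hh | hh)
      · exact notMem_br hh.1
      · exact hxU (hU1.subset hh)
    have hs := score_ge_half T (A := {u', v}) (B := {b₂, b₁}) _ x hxn hwin (by
      refine ⟨v, by simp, ?_⟩
      intro b hb
      simp only [Finset.mem_insert, Finset.mem_singleton] at hb
      rw [dist_eq_one_iff_adj.2 hv.1.symm]
      rcases hb with rfl | rfl
      · exact hc.pos_dist_of_ne (fun hh => notMem_br (hh ▸ hb₂))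
      · exact hc.pos_dist_of_ne (fun hh => hxU (hh ▸ huU)))
    have : Fintype.card V ≤ 3 * ((br T x v \ br T v w) ∪ br T b₁ u').card := by omega
    have : (Fintype.card V : ℝ) ≤ 3 * (((br T x v \ br T v w) ∪ br T b₁ u').card : ℝ) := by
      exact_mod_cast this
    linarith

/-- The heaviest child branch of a good branch. -/
lemma exists_heavy (hc : T.Connected) (h4 : 4 ≤ Fintype.card V) {x v : V} (hv : Good T x v) :
    ∃ v', T.Adj v v' ∧ v' ≠ x ∧
      ∀ w, T.Adj v w → w ≠ x → (br T v w).card ≤ (br T v v').card := by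
  classical
  have hne : (Finset.univ.filter fun w => T.Adj v w ∧ w ≠ x).Nonempty := by
    have h1 : 1 < (br T x v).card := by have := hv.2.1; omega
    obtain ⟨b, hb, hbv⟩ := Finset.exists_mem_ne h1 v
    obtain ⟨w, hw, hm⟩ := exists_br hc hbv
    refine ⟨w, by
      simp only [Finset.mem_filter, Finset.mem_univ, true_and]
      refine ⟨hw, ?_⟩
      rintro rfl
      rw [mem_br] at hb hm
      omega⟩
  obtain ⟨v', h1, h2⟩ := Finset.exists_max_image _ (fun w => (br T v w).card) hne
  simp only [Finset.mem_filter, Finset.mem_univ, true_and] at h1 h2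
  exact ⟨v', h1.1, h1.2, fun w hw hwx => h2 w ⟨hw, hwx⟩⟩

end Tree

end Helpers

/-- For every finite tree `T` with at least 4 vertices, `VR(T, 2) > 1/3`. -/
theorem vr_tree_two_rounds {V : Type*} [Fintype V] [DecidableEq V]
    (T : SimpleGraph V) (hconn : T.Connected) (hacyc : T.IsAcyclic)
    (h4 : 4 ≤ Fintype.card V) :
    (1 / 3 : ℝ) < VR T 2 := by
  by_cases hedge : ∃ p q, T.Adj p q ∧ Fintype.card V ≤ 3 * (br T p q).card ∧
      Fintype.card V ≤ 3 * (br T q p).card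
  · obtain ⟨p, q, hpq, h1, h2⟩ := hedge
    obtain ⟨x, v, hv, hvs⟩ := exists_good hconn hacyc hpq h1
    obtain ⟨y, u, hu, hus⟩ := exists_good hconn hacyc hpq.symm h2
    have hd : Disjoint (br T x v) (br T y u) := by
      rw [Finset.disjoint_left]
      intro z hz hz'
      exact (notMem_br_iff hconn hacyc hpq).2 (hus hz') (hvs hz)
    obtain ⟨v', hv1, hv2, hv3⟩ := exists_heavy hconn h4 hv
    obtain ⟨u', hu1, hu2, hu3⟩ := exists_heavy hconn h4 hu
    by_cases c1 : Fintype.card V + 3 * (br T v v').card <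
        3 * ((br T u u').card + (br T x v).card)
    · exact case_pair hconn hacyc h4 _ hv hu hd hv3 hu1 hu2 (Or.inl c1)
    by_cases c2 : Fintype.card V + 3 * (br T u u').card <
        3 * ((br T v v').card + (br T y u).card)
    · exact case_pair hconn hacyc h4 _ hu hv hd.symm hu3 hv1 hv2 (Or.inl c2)
    have e1 := hv.2.1
    have e2 := hu.2.1
    refine case_pair hconn hacyc h4 _ hv hu hd hv3 hu1 hu2 (Or.inr ⟨by omega, ?_⟩)
    intro hx
    have hvU : v ∉ br T y u := Finset.disjoint_left.1 hd (self_mem_br hv.1)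
    have h5 := dist_cross hconn hacyc hu.1 hx hvU
    rw [dist_eq_one_iff_adj.2 hv.1] at h5
    have hxu : x = u := hconn.dist_eq_zero_iff.1 (by omega)
    have hyv : y = v := hconn.dist_eq_zero_iff.1 (by omega)
    subst hxu hyv
    have hU : br T y x = (br T x y)ᶜ := by
      ext z
      rw [Finset.mem_compl, notMem_br_iff hconn hacyc hv.1]
    have h6 := Finset.card_add_card_compl (br T x y)
    rw [← hU] at h6
    omega
  · push Not at hedge
    by_cases hbig : ∃ p q, T.Adj p q ∧ Fintype.card V ≤ 3 * (br T p q).card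
    · obtain ⟨p, q, hpq, h1⟩ := hbig
      obtain ⟨x, v, hv, -⟩ := exists_good hconn hacyc hpq h1
      refine case_center hconn hacyc h4 v fun w hw => ?_
      by_cases hwx : w = x
      · subst hwx
        exact hedge _ _ hv.1 hv.2.1
      · exact hv.2.2 w hw hwx
    · push Not at hbig
      obtain ⟨c⟩ := hconn.nonempty
      exact case_center hconn hacyc h4 c fun w hw => hbig c w hw
end

section
/- For every real ε > 0 and every integer t ≥ 2, there exists a finite tree T with 2t ≤ |V(T)| such that VR(T, t) < 1/3 + ε. -/
open SimpleGraph

variable {V : Type*}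

namespace Vor

/-! ### Generic facts on the game -/

lemma finite_vals {V : Type*} [Fintype V] (P : V → Prop) (f : V → ℝ) :
    {s : ℝ | ∃ b, P b ∧ s = f b}.Finite := by
  refine (Set.finite_range f).subset ?_
  rintro s ⟨b, _, rfl⟩
  exact ⟨b, rfl⟩

/-- A strategy for B certified by an invariant bounds the game value. -/
lemma gameValue_le {V : Type*} [Fintype V] [DecidableEq V] (G : SimpleGraph V) (C : ℝ) (hC : 0 ≤ C)
    (Inv : ℕ → Finset V → Finset V → Prop)
    (h0 : ∀ A B, Inv 0 A B → scoreA G A B ≤ C)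
    (hs : ∀ r A B a, Inv (r + 1) A B → a ∉ A → a ∉ B →
      ∃ b, b ∉ insert a A ∧ b ∉ B ∧ Inv r (insert a A) (insert b B)) :
    ∀ r A B, Inv r A B → gameValue G r A B ≤ C := by
  intro r
  induction r with
  | zero => intro A B h; simpa [gameValue] using h0 A B h
  | succ r ih =>
    intro A B h
    rw [gameValue]
    refine Real.sSup_le ?_ hC
    rintro x ⟨a, haA, haB, rfl⟩
    obtain ⟨b, hb1, hb2, hb3⟩ := hs r A B a h haA haB
    refine le_trans (csInf_le ?_ ⟨b, hb1, hb2, rfl⟩) (ih _ _ hb3)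
    have := finite_vals (fun b => b ∉ insert a A ∧ b ∉ B)
      (fun b => gameValue G r (insert a A) (insert b B))
    simp only [and_assoc] at this
    exact this.bddBelow

lemma iso_dist_le {V W : Type*} {G : SimpleGraph V} {H : SimpleGraph W} (e : G ≃g H)
    (hG : G.Connected) (u v : V) : H.dist (e u) (e v) ≤ G.dist u v := by
  obtain ⟨w, hw⟩ := hG.exists_walk_length_eq_dist u v
  rw [← hw, ← Walk.length_map e.toHom w]
  exact dist_le _

lemma iso_dist {V W : Type*} {G : SimpleGraph V} {H : SimpleGraph W} (e : G ≃g H)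
    (hG : G.Connected) (u v : V) : H.dist (e u) (e v) = G.dist u v := by
  refine le_antisymm (iso_dist_le e hG u v) ?_
  have := iso_dist_le e.symm (e.connected_iff.1 hG) (e u) (e v)
  simpa using this

lemma distToSet_iso {V W : Type*} (G : SimpleGraph V) (H : SimpleGraph W) (e : G ≃g H)
    (hG : G.Connected) (A : Finset V) (v : V) :
    distToSet H (A.map e.toEquiv.toEmbedding) (e v) = distToSet G A v := by
  unfold distToSet
  rw [Finset.inf_map]
  congr 1
  funext a
  simp only [Function.comp]
  congr 1
  exact iso_dist e hG a v

lemma gameValue_iso {V W : Type*} [Fintype V] [DecidableEq V] [Fintype W] [DecidableEq W]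
    (G : SimpleGraph V) (H : SimpleGraph W) (e : G ≃g H) (hG : G.Connected) :
    ∀ r (A B : Finset V), gameValue H r (A.map e.toEquiv.toEmbedding) (B.map e.toEquiv.toEmbedding)
      = gameValue G r A B := by
  intro r
  induction r with
  | zero =>
    intro A B
    simp only [gameValue, scoreA]
    rw [← e.toEquiv.sum_comp]
    refine Finset.sum_congr rfl fun v _ => ?_
    have h1 := distToSet_iso G H e hG A v
    have h2 := distToSet_iso G H e hG B v
    have h3 : e.toEquiv v = e v := rfl
    rw [h3, h1, h2]
  | succ r ih =>
    intro A B
    have key : ∀ (X : Finset V) (x : V), insert (e x) (X.map e.toEquiv.toEmbedding)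
        = (insert x X).map e.toEquiv.toEmbedding := by
      intro X x; rw [Finset.map_insert]; rfl
    have mem : ∀ (X : Finset V) (x : V), e x ∈ X.map e.toEquiv.toEmbedding ↔ x ∈ X := by
      intro X x; exact Finset.mem_map' e.toEquiv.toEmbedding
    rw [gameValue, gameValue]
    congr 1
    ext x
    simp only [Set.mem_ofPred_eq]
    rw [e.surjective.exists]
    refine exists_congr fun a => ?_
    rw [mem, mem, key]
    refine and_congr_right fun _ => and_congr_right fun _ => ?_
    have : {s : ℝ | ∃ b, b ∉ (insert a A).map e.toEquiv.toEmbedding ∧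
        b ∉ B.map e.toEquiv.toEmbedding ∧
        s = gameValue H r ((insert a A).map e.toEquiv.toEmbedding)
          (insert b (B.map e.toEquiv.toEmbedding))} =
        {s : ℝ | ∃ b, b ∉ insert a A ∧ b ∉ B ∧ s = gameValue G r (insert a A) (insert b B)} := by
      ext s
      simp only [Set.mem_ofPred_eq]
      rw [e.surjective.exists]
      refine exists_congr fun b => ?_
      rw [mem, mem, key, ih]
    rw [this]

lemma distToSet_lt {V : Type*} (G : SimpleGraph V) (A B : Finset V) (v b : V) (hb : b ∈ B)
    (h : ∀ a ∈ A, G.dist b v < G.dist a v) : distToSet G B v < distToSet G A v := by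
  unfold distToSet
  refine lt_of_le_of_lt (Finset.inf_le (f := fun a => (G.dist a v : ℕ∞)) hb) ?_
  rw [Finset.lt_inf_iff (ENat.natCast_lt_top _)]
  intro a ha
  exact_mod_cast h a ha

open Classical in
lemma scoreA_le {V : Type*} [Fintype V] (G : SimpleGraph V) (A B : Finset V) (S : Finset V)
    (h : ∀ v, v ∉ S → distToSet G B v < distToSet G A v) : scoreA G A B ≤ S.card := by
  unfold scoreA
  calc _ ≤ ∑ v : V, if v ∈ S then (1 : ℝ) else 0 := by
        refine Finset.sum_le_sum fun v _ => ?_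
        by_cases hv : v ∈ S
        · rw [if_pos hv]; split_ifs <;> norm_num
        · have := h v hv
          rw [if_neg hv, if_neg this.not_gt, if_neg this.ne']
    _ = S.card := by simp

/-! ### The tree -/

/-- Vertices: a spine with positions `-3^k .. 3^k`, a hub attached to position `0`, `N` leaves at
each of the positions `± 3^(j+1)`, and `k * N` leaves at the hub. -/
inductive Vx (k N : ℕ) : Type
  | sp (i : Set.Icc (-(3 : ℤ) ^ k) (3 ^ k))
  | hub
  | lf (s : Bool) (j : Fin k) (i : Fin N)
  | hl (i : Fin (k * N))

variable {k N : ℕ}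

def vxEquiv (k N : ℕ) : Vx k N ≃ (Set.Icc (-(3 : ℤ) ^ k) (3 ^ k)) ⊕ Unit ⊕
    (Bool × Fin k × Fin N) ⊕ Fin (k * N) where
  toFun v := match v with
    | .sp i => Sum.inl i
    | .hub => Sum.inr (Sum.inl ())
    | .lf s j i => Sum.inr (Sum.inr (Sum.inl (s, j, i)))
    | .hl i => Sum.inr (Sum.inr (Sum.inr i))
  invFun v := match v with
    | Sum.inl i => .sp i
    | Sum.inr (Sum.inl _) => .hub
    | Sum.inr (Sum.inr (Sum.inl (s, j, i))) => .lf s j i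
    | Sum.inr (Sum.inr (Sum.inr i)) => .hl i
  left_inv v := by cases v <;> rfl
  right_inv v := by rcases v with i | i | ⟨s, j, i⟩ | i <;> rfl

noncomputable instance : Fintype (Vx k N) := Fintype.ofEquiv _ (vxEquiv k N).symm
noncomputable instance : DecidableEq (Vx k N) := Classical.decEq _

lemma card_vx : Fintype.card (Vx k N) =
    Fintype.card (Set.Icc (-(3 : ℤ) ^ k) (3 ^ k)) + 1 + 3 * (k * N) := by
  rw [Fintype.card_congr (vxEquiv k N)]
  simp only [Fintype.card_sum, Fintype.card_prod, Fintype.card_fin, Fintype.card_bool,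
    Fintype.card_unit]
  ring

def sg (s : Bool) : ℤ := if s then 1 else -1

lemma sg_cases (s : Bool) : (sg s = 1 ∧ sg (!s) = -1) ∨ (sg s = -1 ∧ sg (!s) = 1) := by
  cases s <;> simp [sg]

lemma sg_not (s : Bool) : sg (!s) = - sg s := by cases s <;> simp [sg]

lemma sg_mul (s : Bool) : sg s * sg s = 1 := by cases s <;> simp [sg]

def col : Vx k N → ℤ
  | .sp i => i.1
  | .hub => 0
  | .lf s j _ => sg s * 3 ^ (j.1 + 1)
  | .hl _ => 0

def ht : Vx k N → ℤ
  | .sp _ => 0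
  | .hub => 1
  | .lf _ _ _ => 1
  | .hl _ => 2

lemma pow_pos' (k : ℕ) : (1 : ℤ) ≤ 3 ^ k := one_le_pow₀ (by norm_num)

/-- spine vertex at (clamped) position `i` -/
def mk (i : ℤ) : Vx k N :=
  .sp ⟨max (-3 ^ k) (min (3 ^ k) i), le_max_left _ _, by
    have := pow_pos' k
    exact max_le (by linarith) (min_le_left _ _)⟩

lemma col_mk {i : ℤ} (h1 : -3 ^ k ≤ i) (h2 : i ≤ 3 ^ k) : col (mk i : Vx k N) = i := by
  simp only [mk, col]
  rw [min_eq_right h2, max_eq_right h1]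

lemma sp_eq (i : Set.Icc (-(3 : ℤ) ^ k) (3 ^ k)) : (Vx.sp i : Vx k N) = mk i.1 := by
  obtain ⟨i, h1, h2⟩ := i
  simp only [mk]
  congr 2
  rw [min_eq_right h2, max_eq_right h1]

lemma col_bound (v : Vx k N) : -3 ^ k ≤ col v ∧ col v ≤ 3 ^ k := by
  have h0 := pow_pos' k
  cases v with
  | sp i => exact i.2
  | hub => simp only [col]; constructor <;> linarith
  | hl i => simp only [col]; constructor <;> linarith
  | lf s j i =>
    have : (3 : ℤ) ^ (j.1 + 1) ≤ 3 ^ k := pow_le_pow_right₀ (by norm_num) j.2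
    have := pow_pos' (j.1 + 1)
    rcases sg_cases s with h | h <;> simp only [col, h.1] <;> constructor <;> linarith

lemma ht_nonneg (v : Vx k N) : 0 ≤ ht v := by cases v <;> simp [ht]

lemma eq_mk_of_ht {v : Vx k N} (h : ht v = 0) : v = mk (col v) := by
  cases v with
  | sp i => exact sp_eq i
  | hub => simp [ht] at h
  | lf => simp [ht] at h
  | hl => simp [ht] at h

lemma ht_mk (i : ℤ) : ht (mk i : Vx k N) = 0 := rfl

def par : Vx k N → Vx k N
  | .sp i => mk (i.1 - i.1.sign)
  | .hub => mk 0
  | .lf s j _ => mk (sg s * 3 ^ (j.1 + 1))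
  | .hl _ => .hub

def TG (k N : ℕ) : SimpleGraph (Vx k N) := SimpleGraph.fromRel fun u v => par u = v

lemma reach_par (v : Vx k N) : (TG k N).Reachable v (par v) := by
  by_cases h : v = par v
  · rw [← h]
  · exact Adj.reachable (by rw [TG, fromRel_adj]; exact ⟨h, Or.inl rfl⟩)

lemma reach_sp (n : ℕ) : ∀ i : ℤ, i.natAbs = n → -3 ^ k ≤ i → i ≤ 3 ^ k →
    (TG k N).Reachable (mk i) (mk 0) := by
  induction n with
  | zero => intro i hi _ _; obtain rfl : i = 0 := by omega
            exact Reachable.refl _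
  | succ n ih =>
    intro i hi h1 h2
    have hs := reach_par (mk i : Vx k N)
    have hc : par (mk i : Vx k N) = mk (i - i.sign) := by
      have : (max (-3 ^ k) (min (3 ^ k) i)) = i := by rw [min_eq_right h2, max_eq_right h1]
      simp only [mk, par, this]
    rw [hc] at hs
    have h0 := pow_pos' k
    rcases lt_trichotomy i 0 with h | h | h
    · rw [Int.sign_eq_neg_one_of_neg h] at hs
      exact hs.trans (ih _ (by omega) (by linarith) (by linarith))
    · omega
    · rw [Int.sign_eq_one_of_pos h] at hs
      exact hs.trans (ih _ (by omega) (by linarith) (by linarith))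

lemma reach_root (v : Vx k N) : (TG k N).Reachable v (mk 0) := by
  have hsp : ∀ i : ℤ, -3 ^ k ≤ i → i ≤ 3 ^ k → (TG k N).Reachable (mk i) (mk 0) :=
    fun i h1 h2 => reach_sp _ i rfl h1 h2
  cases v with
  | sp i => rw [sp_eq]; exact hsp _ i.2.1 i.2.2
  | hub => exact reach_par Vx.hub
  | lf s j i =>
    have hb := col_bound (Vx.lf s j i)
    exact (reach_par (Vx.lf s j i)).trans (hsp _ hb.1 hb.2)
  | hl i => exact (reach_par (Vx.hl i)).trans (reach_par Vx.hub)

lemma connected : (TG k N).Connected := by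
  have : Nonempty (Vx k N) := ⟨.hub⟩
  exact ⟨fun u v => (reach_root u).trans (reach_root v).symm⟩

lemma par_root : par (mk 0 : Vx k N) = mk 0 := by
  have := pow_pos' k
  have : (max (-3 ^ k) (min (3 ^ k) (0 : ℤ))) = 0 := by
    rw [min_eq_right (by linarith), max_eq_right (by linarith)]
  simp only [par, mk, this, Int.sign_zero, sub_zero]

lemma isTree : (TG k N).IsTree := by
  classical
  rw [isTree_iff_connected_and_card]
  refine ⟨connected, le_antisymm ?_ connected.card_vert_le_card_edgeSet_add_one⟩
  have hsub : (TG k N).edgeSet ⊆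
      ((Finset.univ.erase (mk 0 : Vx k N)).image (fun v => s(v, par v)) : Finset _) := by
    intro e
    induction e with
    | h u v =>
      intro h
      rw [mem_edgeSet, TG, fromRel_adj] at h
      obtain ⟨hne, h | h⟩ := h
      · simp only [Finset.coe_image, Set.mem_image]
        refine ⟨u, ?_, by rw [h]⟩
        simp only [Finset.coe_erase, Finset.coe_univ, Set.mem_sdiff, Set.mem_univ, true_and,
          Set.mem_singleton_iff]
        rintro rfl
        rw [par_root] at h
        exact hne h
      · simp only [Finset.coe_image, Set.mem_image]
        refine ⟨v, ?_, by rw [h]; exact Sym2.eq_swap⟩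
        simp only [Finset.coe_erase, Finset.coe_univ, Set.mem_sdiff, Set.mem_univ, true_and,
          Set.mem_singleton_iff]
        rintro rfl
        rw [par_root] at h
        exact hne h.symm
  have h1 := Set.ncard_le_ncard hsub (Finset.finite_toSet _)
  rw [Set.ncard_coe_finset] at h1
  have h2 := h1.trans Finset.card_image_le
  rw [Finset.card_erase_of_mem (Finset.mem_univ _), Finset.card_univ] at h2
  have h3 : 0 < Fintype.card (Vx k N) := Fintype.card_pos_iff.2 ⟨.hub⟩
  rw [Nat.card_coe_set_eq, Nat.card_eq_fintype_card]
  omega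

/-! ### Distances -/

lemma lip (g : Vx k N → ℤ) (hg : ∀ u, |g u - g (par u)| ≤ 1) (u v : Vx k N) :
    g u - g v ≤ (TG k N).dist u v := by
  obtain ⟨w, hw⟩ := connected.exists_walk_length_eq_dist u v
  rw [← hw]
  clear hw
  induction w with
  | nil => simp
  | @cons a b c h p ih =>
    rw [TG, fromRel_adj] at h
    have : g a - g b ≤ 1 := by
      rcases h with ⟨_, h | h⟩
      · rw [← h]; exact (abs_le.1 (hg a)).2
      · rw [← h]; have := (abs_le.1 (hg b)).1; linarith
    simp only [Walk.length_cons]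
    push_cast
    linarith

lemma dist_par (v : Vx k N) : ((TG k N).dist v (par v) : ℤ) ≤ 1 := by
  by_cases h : v = par v
  · rw [← h]; simp
  · have : (TG k N).Adj v (par v) := by rw [TG, fromRel_adj]; exact ⟨h, Or.inl rfl⟩
    rw [dist_eq_one_iff_adj.2 this]; simp

lemma tri (u v w : Vx k N) :
    ((TG k N).dist u w : ℤ) ≤ (TG k N).dist u v + (TG k N).dist v w := by
  exact_mod_cast connected.dist_triangle

lemma par_mk {i : ℤ} (h1 : -3 ^ k ≤ i) (h2 : i ≤ 3 ^ k) :
    par (mk i : Vx k N) = mk (i - i.sign) := by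
  have : (max (-3 ^ k) (min (3 ^ k) i)) = i := by rw [min_eq_right h2, max_eq_right h1]
  simp only [mk, par, this]

lemma dist_leg (s : Bool) (n m : ℕ) (hm : ((n + m : ℕ) : ℤ) ≤ 3 ^ k) :
    ((TG k N).dist (mk (sg s * n)) (mk (sg s * (n + m : ℕ))) : ℤ) ≤ m := by
  induction m with
  | zero => simp
  | succ m ih =>
    have h1 := ih (by push_cast at hm ⊢; linarith)
    have h2 := dist_par (mk (sg s * (n + (m + 1) : ℕ)) : Vx k N)
    have hk := pow_pos' k
    rw [par_mk] at h2
    · have : sg s * ((n + (m + 1) : ℕ) : ℤ) - (sg s * ((n + (m + 1) : ℕ) : ℤ)).sign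
          = sg s * (n + m : ℕ) := by
        have hp : (0 : ℤ) < ((n + (m + 1) : ℕ) : ℤ) := by positivity
        rw [Int.sign_mul, Int.sign_eq_one_of_pos hp]
        rcases sg_cases s with h | h <;> rw [h.1] <;> simp <;> ring
      rw [this, SimpleGraph.dist_comm] at h2
      have h3 := tri (mk (sg s * n)) (mk (sg s * (n + m : ℕ))) (mk (sg s * (n + (m + 1) : ℕ)) : Vx k N)
      push_cast at *
      linarith
    · rcases sg_cases s with h | h <;> rw [h.1] <;> push_cast at * <;> linarith
    · rcases sg_cases s with h | h <;> rw [h.1] <;> push_cast at * <;> linarith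

/-- Distance from a spine vertex to a leaf further out. -/
lemma dist_sp_lf (s : Bool) (j : Fin k) (i : Fin N) (q : ℤ) (h0 : 0 ≤ q) (hq : q ≤ 3 ^ (j.1 + 1)) :
    ((TG k N).dist (mk (sg s * q)) (.lf s j i) : ℤ) ≤ 3 ^ (j.1 + 1) - q + 1 := by
  have hle : (3 : ℤ) ^ (j.1 + 1) ≤ 3 ^ k := pow_le_pow_right₀ (by norm_num) j.2
  obtain ⟨n, rfl⟩ := Int.eq_ofNat_of_zero_le h0
  obtain ⟨m, hm⟩ := Int.eq_ofNat_of_zero_le (sub_nonneg.2 hq)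
  have hsum : ((n + m : ℕ) : ℤ) = 3 ^ (j.1 + 1) := by push_cast; linarith
  have h1 := dist_leg (N := N) (k := k) s n m (by rw [hsum]; exact hle)
  rw [hsum] at h1
  have h2 := dist_par (.lf s j i : Vx k N)
  rw [SimpleGraph.dist_comm] at h2
  have h3 := tri (mk (sg s * n)) (mk (sg s * 3 ^ (j.1 + 1))) (.lf s j i : Vx k N)
  simp only [par] at h2
  linarith

lemma dist_hub_lf (s : Bool) (j : Fin k) (i : Fin N) :
    ((TG k N).dist .hub (.lf s j i) : ℤ) ≤ 3 ^ (j.1 + 1) + 2 := by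
  have h1 := dist_sp_lf s j i 0 le_rfl (by positivity)
  rw [mul_zero] at h1
  have h2 := dist_par (.hub : Vx k N)
  have h3 := tri .hub (mk 0) (.lf s j i : Vx k N)
  simp only [par] at h2
  linarith

lemma dist_hub_hl (i : Fin (k * N)) : ((TG k N).dist .hub (.hl i) : ℤ) ≤ 1 := by
  have := dist_par (.hl i : Vx k N)
  rw [SimpleGraph.dist_comm] at this
  exact this

lemma dist_sp_hl (i : Fin (k * N)) : ((TG k N).dist (mk 0) (.hl i) : ℤ) ≤ 2 := by
  have h1 := dist_hub_hl (N := N) i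
  have h2 := dist_par (.hub : Vx k N)
  rw [SimpleGraph.dist_comm] at h2
  have h3 := tri (mk 0) .hub (.hl i : Vx k N)
  simp only [par] at h2
  linarith

lemma sub_sign_bounds (i : ℤ) : (i = 0 ∧ i.sign = 0) ∨ (0 < i ∧ i.sign = 1) ∨ (i < 0 ∧ i.sign = -1) := by
  rcases lt_trichotomy i 0 with h | h | h
  · exact Or.inr (Or.inr ⟨h, Int.sign_eq_neg_one_of_neg h⟩)
  · exact Or.inl ⟨h, by rw [h]; rfl⟩
  · exact Or.inr (Or.inl ⟨h, Int.sign_eq_one_of_pos h⟩)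

lemma col_par_sp (i : Set.Icc (-(3 : ℤ) ^ k) (3 ^ k)) :
    col (mk (i.1 - i.1.sign) : Vx k N) = i.1 - i.1.sign := by
  have h1 := i.2.1
  have h2 := i.2.2
  have h3 := pow_pos' k
  apply col_mk <;> rcases sub_sign_bounds i.1 with h | h | h <;> rw [h.2] <;> linarith [h.1]

lemma col_par_lf (s : Bool) (j : Fin k) :
    col (mk (sg s * 3 ^ (j.1 + 1)) : Vx k N) = sg s * 3 ^ (j.1 + 1) := by
  have : (3 : ℤ) ^ (j.1 + 1) ≤ 3 ^ k := pow_le_pow_right₀ (by norm_num) j.2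
  have := pow_pos' (j.1 + 1)
  apply col_mk <;> rcases sg_cases s with h | h <;> rw [h.1] <;> linarith

lemma mk_zero_col : col (mk 0 : Vx k N) = 0 := by
  have := pow_pos' k
  apply col_mk <;> linarith

lemma lower_lf (s : Bool) (j : Fin k) (i : Fin N) (u : Vx k N) (hu : u ≠ .lf s j i) :
    |col u - sg s * 3 ^ (j.1 + 1)| + ht u + 1 ≤ ((TG k N).dist u (.lf s j i) : ℤ) := by
  have key := lip (fun u : Vx k N => if u = .lf s j i then -1 else
    |col u - sg s * 3 ^ (j.1 + 1)| + ht u) ?_ u (.lf s j i)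
  · simp only [if_neg hu, if_true] at key
    linarith
  · intro u
    cases u with
    | sp x =>
      have h1 : (Vx.sp x : Vx k N) ≠ .lf s j i := by simp
      have h2 : (par (Vx.sp x) : Vx k N) ≠ .lf s j i := by simp [par, mk]
      simp only [if_neg h1, if_neg h2]
      simp only [par, col_par_sp, ht_mk]
      simp only [col, ht]
      have : |(|x.1 - sg s * 3 ^ (j.1 + 1)| - |x.1 - x.1.sign - sg s * 3 ^ (j.1 + 1)|)| ≤ 1 := by
        refine (abs_abs_sub_abs_le _ _).trans ?_
        rcases sub_sign_bounds x.1 with h | h | h <;> rw [h.2] <;> ring_nf <;> simp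
      simpa using this
    | hub =>
      have h1 : (Vx.hub : Vx k N) ≠ .lf s j i := by simp
      have h2 : (par Vx.hub : Vx k N) ≠ .lf s j i := by simp [par, mk]
      simp only [if_neg h1, if_neg h2]
      simp only [par, mk_zero_col, ht_mk]
      simp [col, ht]
    | hl x =>
      have h1 : (Vx.hl x : Vx k N) ≠ .lf s j i := by simp
      have h2 : (par (Vx.hl x) : Vx k N) ≠ .lf s j i := by simp [par]
      simp only [if_neg h1, if_neg h2]
      simp [par, col, ht]
    | lf s' j' i' =>
      have h2 : (par (Vx.lf s' j' i') : Vx k N) ≠ .lf s j i := by simp [par, mk]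
      simp only [if_neg h2]
      simp only [par, col_par_lf, ht_mk]
      split_ifs with h
      · obtain ⟨rfl, rfl, rfl⟩ := Vx.lf.inj h
        simp
      · simp [col, ht]

lemma lower_hl (i : Fin (k * N)) (u : Vx k N) :
    (if u = .hl i then 0 else if u = .hub then 1 else |col u| + 2)
      ≤ ((TG k N).dist u (.hl i) : ℤ) := by
  have key := lip (fun u : Vx k N => if u = .hl i then (0 : ℤ) else if u = .hub then 1 else
    |col u| + 2) ?_ u (.hl i)
  · simp only [if_true, sub_zero] at key
    exact key
  · intro u
    cases u with
    | sp x =>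
      simp only [par, col_par_sp]
      simp only [mk, col, reduceCtorEq, if_false]
      have : |(|x.1| - |x.1 - x.1.sign|)| ≤ 1 := by
        refine (abs_abs_sub_abs_le _ _).trans ?_
        rcases sub_sign_bounds x.1 with h | h | h <;> rw [h.2] <;> ring_nf <;> simp
      simpa using this
    | hub =>
      simp only [par, mk_zero_col]
      simp [mk]
    | hl x =>
      simp only [par]
      simp only [reduceCtorEq, if_false, if_true, col]
      split_ifs <;> simp
    | lf s' j' i' =>
      simp only [par, col_par_lf]
      simp [mk, col]

/-! ### Held regions -/

def InvL (s : Bool) (A B : Finset (Vx k N)) : Prop :=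
  ∀ a ∈ A, 1 ≤ sg s * col a → sg s * col a < 3 ^ k → mk (col a + sg s) ∈ A ∪ B

def GateR (s : Bool) (A B : Finset (Vx k N)) : Prop := mk (sg s) ∈ A ∪ B ∨ mk 0 ∈ B

def Gate (s : Bool) (A B : Finset (Vx k N)) : Prop :=
  GateR s A B ∨ (Vx.hub ∈ B ∧ mk 0 ∉ A ∧ mk (sg (!s)) ∉ A)

def LegHeld (s : Bool) (A B : Finset (Vx k N)) : Prop := InvL s A B ∧ Gate s A B

def HubHeld (A B : Finset (Vx k N)) : Prop :=
  Vx.hub ∈ B ∨ (mk 0 ∈ B ∧ ∀ a ∈ A, col a ≠ 0)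

lemma col_mk_sg (s : Bool) : col (mk (sg s) : Vx k N) = sg s := by
  have := pow_pos' k
  apply col_mk <;> rcases sg_cases s with h | h <;> rw [h.1] <;> linarith

lemma sg_sub_abs (s : Bool) (x p : ℤ) : |x - sg s * p| = |sg s * x - p| := by
  rcases sg_cases s with h | h <;> rw [h.1]
  · simp
  · rw [← abs_neg]; congr 1; ring

lemma held (s : Bool) (A B : Finset (Vx k N)) (hd : Disjoint A B) (hL : LegHeld s A B)
    (j : Fin k) (i : Fin N) :
    (∃ a ∈ A, 3 ^ (j.1 + 1) ≤ sg s * col a ∧ sg s * col a < 3 * 3 ^ (j.1 + 1)) ∨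
    distToSet (TG k N) B (.lf s j i) < distToSet (TG k N) A (.lf s j i) := by
  obtain ⟨hI, hG⟩ := hL
  by_cases hno : ∃ a ∈ A, 3 ^ (j.1 + 1) ≤ sg s * col a ∧ sg s * col a < 3 * 3 ^ (j.1 + 1)
  · exact Or.inl hno
  right
  push Not at hno
  have hp3 : (3 : ℤ) ≤ 3 ^ (j.1 + 1) := by
    have := pow_pos' j.1
    rw [pow_succ]; linarith
  have hpk : (3 : ℤ) ^ (j.1 + 1) ≤ 3 ^ k := pow_le_pow_right₀ (by norm_num) j.2
  have hlow : ∀ a ∈ A, |sg s * col a - 3 ^ (j.1 + 1)| + ht a + 1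
      ≤ ((TG k N).dist a (.lf s j i) : ℤ) := by
    intro a ha
    have hne : a ≠ .lf s j i := by
      rintro rfl
      have h1 := hno _ ha
      have h2 : sg s * col (Vx.lf s j i : Vx k N) = 3 ^ (j.1 + 1) := by
        simp only [col]; rw [← mul_assoc, sg_mul, one_mul]
      rw [h2] at h1
      have := h1 le_rfl
      linarith
    have := lower_lf s j i a hne
    rwa [sg_sub_abs] at this
  have fin : ∀ b ∈ B, ∀ D : ℤ, ((TG k N).dist b (.lf s j i) : ℤ) ≤ D →
      (∀ a ∈ A, D < |sg s * col a - 3 ^ (j.1 + 1)| + ht a + 1) →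
      distToSet (TG k N) B (.lf s j i) < distToSet (TG k N) A (.lf s j i) := by
    intro b hb D h1 h2
    refine distToSet_lt _ _ _ _ b hb fun a ha => ?_
    have := h2 a ha
    have := hlow a ha
    have : ((TG k N).dist b (.lf s j i) : ℤ) < (TG k N).dist a (.lf s j i) := by linarith
    exact_mod_cast this
  generalize hpdef : (3 : ℤ) ^ (j.1 + 1) = p at *
  by_cases hex : ∃ a ∈ A, 1 ≤ sg s * col a ∧ sg s * col a < p
  · obtain ⟨a0, ha0, hmax⟩ := Finset.exists_max_image
      (A.filter fun a => 1 ≤ sg s * col a ∧ sg s * col a < p) (fun a => sg s * col a)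
      (by obtain ⟨a, h1, h2⟩ := hex; exact ⟨a, Finset.mem_filter.2 ⟨h1, h2⟩⟩)
    rw [Finset.mem_filter] at ha0
    obtain ⟨hA0, h1, h2⟩ := ha0
    have hmem := hI a0 hA0 h1 (by linarith)
    have he : col a0 + sg s = sg s * (sg s * col a0 + 1) := by
      rw [mul_add, ← mul_assoc, sg_mul]; ring
    have hc : col (mk (col a0 + sg s) : Vx k N) = col a0 + sg s := by
      have hb := col_bound a0
      rcases sg_cases s with h | h <;> rw [h.1] at h1 h2 ⊢ <;> apply col_mk <;> linarith
    have hc' : sg s * col (mk (col a0 + sg s) : Vx k N) = sg s * col a0 + 1 := by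
      rw [hc, mul_add, sg_mul]
    have hB : (mk (col a0 + sg s) : Vx k N) ∈ B := by
      rcases Finset.mem_union.1 hmem with h | h
      · exfalso
        by_cases hlt : sg s * col a0 + 1 < p
        · have := hmax _ (Finset.mem_filter.2 ⟨h, by rw [hc']; constructor <;> linarith⟩)
          rw [hc'] at this
          linarith
        · have := hno _ h (by rw [hc']; linarith)
          rw [hc'] at this
          linarith
      · exact h
    have hdist := dist_sp_lf s j i (sg s * col a0 + 1) (by linarith) (by rw [hpdef]; linarith)
    rw [← he, hpdef] at hdist
    refine fin _ hB _ hdist ?_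
    intro a ha
    have hh := ht_nonneg a
    by_cases hlt : sg s * col a < p
    · have hle : sg s * col a ≤ sg s * col a0 := by
        by_cases h1' : 1 ≤ sg s * col a
        · exact hmax _ (Finset.mem_filter.2 ⟨ha, h1', hlt⟩)
        · linarith
      rw [abs_of_neg (by linarith)]
      linarith
    · have := hno a ha (by linarith)
      rw [abs_of_nonneg (by linarith)]
      linarith
  · push Not at hex
    have hcases : ∀ a ∈ A, sg s * col a ≤ 0 ∨ 3 * p ≤ sg s * col a := by
      intro a ha
      by_cases h1 : 1 ≤ sg s * col a
      · exact Or.inr (hno a ha (hex a ha h1))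
      · left; linarith
    rcases hG with (h | h) | ⟨h, h0, h1⟩
    · have hB : (mk (sg s) : Vx k N) ∈ B := by
        rcases Finset.mem_union.1 h with h | h
        · exfalso
          have := hcases _ h
          rw [col_mk_sg, sg_mul] at this
          rcases this with h | h <;> linarith
        · exact h
      have hdist := dist_sp_lf s j i 1 (by linarith) (by rw [hpdef]; linarith)
      rw [mul_one, hpdef] at hdist
      refine fin _ hB _ hdist ?_
      intro a ha
      have hh := ht_nonneg a
      rcases hcases a ha with h | h
      · rw [abs_of_neg (by linarith)]; linarith
      · rw [abs_of_nonneg (by linarith)]; linarith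
    · have hdist := dist_sp_lf s j i 0 le_rfl (by rw [hpdef]; linarith)
      rw [mul_zero, hpdef] at hdist
      refine fin _ h _ hdist ?_
      intro a ha
      have hh := ht_nonneg a
      rcases hcases a ha with h' | h'
      · rw [abs_of_neg (by linarith)]
        by_contra hcon
        have e1 : sg s * col a = 0 := by linarith
        have e2 : ht a = 0 := by linarith
        have e3 : col a = 0 := by
          rcases sg_cases s with h | h <;> rw [h.1] at e1 <;> linarith
        have e4 := eq_mk_of_ht e2
        rw [e3] at e4
        rw [e4] at ha
        exact Finset.disjoint_left.1 hd ha h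
      · rw [abs_of_nonneg (by linarith)]; linarith
    · have hdist := dist_hub_lf s j i
      rw [hpdef] at hdist
      refine fin _ h _ hdist ?_
      intro a ha
      have hh := ht_nonneg a
      rcases hcases a ha with h' | h'
      · rw [abs_of_neg (by linarith)]
        by_contra hcon
        have hz : ∀ x : ℤ, sg s * col a = x → col a = sg s * x := by
          intro x hx; rw [← hx, ← mul_assoc, sg_mul, one_mul]
        have hsum : - (sg s * col a) + ht a ≤ 1 := by linarith
        by_cases e2 : ht a = 0
        · have e4 := eq_mk_of_ht e2
          by_cases e1 : sg s * col a = 0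
          · rw [hz _ e1, mul_zero] at e4
            rw [e4] at ha; exact h0 ha
          · have e1 : sg s * col a = -1 := by omega
            rw [hz _ e1, mul_neg, mul_one, ← sg_not] at e4
            rw [e4] at ha; exact h1 ha
        · have e2' : ht a = 1 := by omega
          have e1 : sg s * col a = 0 := by omega
          have e3 := hz _ e1
          rw [mul_zero] at e3
          cases a with
          | sp x => simp [ht] at e2
          | hub => exact Finset.disjoint_left.1 hd ha h
          | hl x => simp [ht] at e2'
          | lf s' j' i' =>
            simp only [col] at e3
            have := pow_pos' (j'.1 + 1)
            rcases sg_cases s' with h | h <;> rw [h.1] at e3 <;> linarith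
      · rw [abs_of_nonneg (by linarith)]; linarith

lemma hubHeld (A B : Finset (Vx k N)) (hd : Disjoint A B) (h : HubHeld A B) (i : Fin (k * N))
    (hi : Vx.hl i ∉ A) :
    distToSet (TG k N) B (.hl i) < distToSet (TG k N) A (.hl i) := by
  rcases h with h | ⟨h, hA⟩
  · refine distToSet_lt _ _ _ _ _ h fun a ha => ?_
    have h1 := dist_hub_hl (N := N) i
    have h2 := lower_hl i a
    rw [if_neg (by rintro rfl; exact hi ha),
      if_neg (by rintro rfl; exact Finset.disjoint_left.1 hd ha h)] at h2
    have := abs_nonneg (col a)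
    zify
    linarith
  · refine distToSet_lt _ _ _ _ _ h fun a ha => ?_
    have h1 := dist_sp_hl (N := N) i
    have h2 := lower_hl i a
    rw [if_neg (by rintro rfl; exact hi ha),
      if_neg (by rintro rfl; exact hA _ ha rfl)] at h2
    have := abs_pos.2 (hA a ha)
    zify
    linarith

open Classical in
/-- the leaves of a held leg that A may get -/
noncomputable def HS (s : Bool) (A : Finset (Vx k N)) : Finset (Vx k N) :=
  ((Finset.univ.filter fun j : Fin k =>
    ∃ a ∈ A, 3 ^ (j.1 + 1) ≤ sg s * col a ∧ sg s * col a < 3 * 3 ^ (j.1 + 1)) ×ˢ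
    (Finset.univ : Finset (Fin N))).image fun x => Vx.lf s x.1 x.2

lemma card_HS (s : Bool) (A : Finset (Vx k N)) : (HS s A).card ≤ A.card * N := by
  classical
  unfold HS
  refine Finset.card_image_le.trans ?_
  rw [Finset.card_product, Finset.card_univ, Fintype.card_fin]
  refine Nat.mul_le_mul_right _ ?_
  set J := Finset.univ.filter fun j : Fin k =>
    ∃ a ∈ A, 3 ^ (j.1 + 1) ≤ sg s * col a ∧ sg s * col a < 3 * 3 ^ (j.1 + 1) with hJ
  have hch : ∀ j : Fin k, ∃ a : Vx k N, j ∈ J →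
      (a ∈ A ∧ 3 ^ (j.1 + 1) ≤ sg s * col a ∧ sg s * col a < 3 * 3 ^ (j.1 + 1)) := by
    intro j
    by_cases h : j ∈ J
    · obtain ⟨a, h1, h2⟩ := (Finset.mem_filter.1 h).2
      exact ⟨a, fun _ => ⟨h1, h2⟩⟩
    · exact ⟨.hub, fun h' => absurd h' h⟩
  choose f hf using hch
  refine Finset.card_le_card_of_injOn f (fun j hj => (hf j hj).1) ?_
  have aux : ∀ j ∈ J, ∀ j' ∈ J, f j = f j' → ¬ j < j' := by
    intro j hj j' hj' he hlt
    have h1 := (hf j hj).2.2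
    have h2 := (hf j' hj').2.1
    rw [he] at h1
    have h3 : (3 : ℤ) ^ (j.1 + 1 + 1) ≤ 3 ^ (j'.1 + 1) :=
      pow_le_pow_right₀ (by norm_num) (by have : j.1 < j'.1 := hlt; omega)
    rw [pow_succ _ (j.1 + 1)] at h3
    linarith
  intro j hj j' hj' he
  exact le_antisymm (not_lt.1 (aux j' hj' j hj he.symm)) (not_lt.1 (aux j hj j' hj' he))

def Fin2 (A B : Finset (Vx k N)) : Prop :=
  (HubHeld A B ∧ ∃ s, LegHeld s A B) ∨ ∀ s, LegHeld s A B

lemma score_final (A B : Finset (Vx k N)) (hd : Disjoint A B) (h : Fin2 A B) :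
    scoreA (TG k N) A B ≤ ((Fintype.card (Set.Icc (-(3 : ℤ) ^ k) (3 ^ k)) + 1 + k * N
      + A.card + 2 * (A.card * N) : ℕ) : ℝ) := by
  classical
  set S0 : Finset (Vx k N) := insert .hub (Finset.univ.image .sp) with hS0
  have c0 : S0.card ≤ Fintype.card (Set.Icc (-(3 : ℤ) ^ k) (3 ^ k)) + 1 := by
    refine (Finset.card_insert_le _ _).trans ?_
    exact Nat.add_le_add_right Finset.card_image_le _
  have m0 : ∀ i, (Vx.sp i : Vx k N) ∈ S0 := fun i => by simp [hS0]
  have m1 : (Vx.hub : Vx k N) ∈ S0 := by simp [hS0]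
  have mh : ∀ s j i, (∃ a ∈ A, 3 ^ (j.1 + 1) ≤ sg s * col a ∧
      sg s * col a < 3 * 3 ^ (j.1 + 1)) → (Vx.lf s j i : Vx k N) ∈ HS s A := by
    intro s j i hh
    unfold HS
    exact Finset.mem_image.2 ⟨(j, i), by simpa using hh, rfl⟩
  rcases h with ⟨hh, s, hs⟩ | h
  · set F : Finset (Vx k N) := (Finset.univ : Finset (Fin k × Fin N)).image
      fun x => Vx.lf (!s) x.1 x.2 with hF
    have cF : F.card ≤ k * N := by
      refine Finset.card_image_le.trans ?_
      simp
    refine (scoreA_le _ A B (S0 ∪ A ∪ HS s A ∪ F) ?_).trans ?_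
    · intro v hv
      simp only [Finset.mem_union, not_or] at hv
      obtain ⟨⟨⟨v1, v2⟩, v3⟩, v4⟩ := hv
      cases v with
      | sp i => exact absurd (m0 i) v1
      | hub => exact absurd m1 v1
      | hl i => exact hubHeld A B hd hh i v2
      | lf s' j i =>
        by_cases hs' : s' = s
        · subst hs'
          exact (held s' A B hd hs j i).resolve_left fun hc => v3 (mh _ _ _ hc)
        · have : s' = !s := by cases s <;> cases s' <;> simp_all
          subst this
          exact absurd (Finset.mem_image.2 ⟨(j, i), Finset.mem_univ _, rfl⟩) v4
    · have h1 := Finset.card_union_le (S0 ∪ A ∪ HS s A) F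
      have h2 := Finset.card_union_le (S0 ∪ A) (HS s A)
      have h3 := Finset.card_union_le S0 A
      have h4 := card_HS s A
      exact_mod_cast by omega
  · set F : Finset (Vx k N) := (Finset.univ : Finset (Fin (k * N))).image .hl with hF
    have cF : F.card ≤ k * N := by
      refine Finset.card_image_le.trans ?_
      simp
    refine (scoreA_le _ A B (S0 ∪ HS true A ∪ HS false A ∪ F) ?_).trans ?_
    · intro v hv
      simp only [Finset.mem_union, not_or] at hv
      obtain ⟨⟨⟨v1, v2⟩, v3⟩, v4⟩ := hv
      cases v with
      | sp i => exact absurd (m0 i) v1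
      | hub => exact absurd m1 v1
      | hl i => exact absurd (Finset.mem_image.2 ⟨i, Finset.mem_univ _, rfl⟩) v4
      | lf s' j i =>
        refine (held s' A B hd (h s') j i).resolve_left fun hc => ?_
        cases s'
        · exact v3 (mh _ _ _ hc)
        · exact v2 (mh _ _ _ hc)
    · have h1 := Finset.card_union_le (S0 ∪ HS true A ∪ HS false A) F
      have h2 := Finset.card_union_le (S0 ∪ HS true A) (HS false A)
      have h3 := Finset.card_union_le S0 (HS true A)
      have h4 := card_HS true A
      have h5 := card_HS false A
      exact_mod_cast by omega

/-! ### B's strategy -/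

def StS (s : Bool) (A B : Finset (Vx k N)) : Prop :=
  (∀ a ∈ A, 1 ≤ sg s * col a) ∧ InvL s A B ∧ mk (sg s) ∈ A

def Main (r : ℕ) (A B : Finset (Vx k N)) : Prop :=
  (∃ s, Vx.hub ∈ B ∧ LegHeld s A B) ∨ (∀ s, InvL s A B ∧ GateR s A B) ∨
  (1 ≤ r ∧ ∃ s, StS s A B) ∨ (1 ≤ r ∧ A = {mk 0} ∧ Vx.hub ∈ B) ∨
  (r = 0 ∧ Fin2 A B) ∨ (2 ≤ r ∧ A = ∅)

lemma main_zero (A B : Finset (Vx k N)) (h : Main 0 A B) : Fin2 A B := by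
  rcases h with ⟨s, h1, h2⟩ | h | h | h | h | h
  · exact Or.inl ⟨Or.inl h1, s, h2⟩
  · exact Or.inr fun s => ⟨(h s).1, Or.inl (h s).2⟩
  · omega
  · omega
  · exact h.2
  · omega

section step
variable {A B : Finset (Vx k N)} {a b : Vx k N} {s : Bool}

lemma mem_mono {x : Vx k N} (h : x ∈ A ∪ B) : x ∈ insert a A ∪ insert b B := by
  simp only [Finset.mem_union, Finset.mem_insert] at *
  tauto

lemma invL_out (h : InvL s A B) (ha : sg s * col a ≤ 0) : InvL s (insert a A) (insert b B) := by
  intro x hx h1 h2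
  rcases Finset.mem_insert.1 hx with rfl | hx
  · linarith
  · exact mem_mono (h x hx h1 h2)

lemma invL_in (h : InvL s A B) (ha : mk (col a + sg s) ∈ insert a A ∪ insert b B) :
    InvL s (insert a A) (insert b B) := by
  intro x hx h1 h2
  rcases Finset.mem_insert.1 hx with rfl | hx
  · exact ha
  · exact mem_mono (h x hx h1 h2)

lemma invL_vac (h : ∀ x ∈ A, sg s * col x ≤ 0) : InvL s A B := by
  intro x hx h1 _
  have := h x hx
  linarith

lemma gateR_mono (h : GateR s A B) : GateR s (insert a A) (insert b B) := by
  rcases h with h | h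
  · exact Or.inl (mem_mono h)
  · exact Or.inr (Finset.mem_insert_of_mem h)

lemma gate_in (h : Gate s A B) (ha : 1 ≤ sg s * col a) : Gate s (insert a A) (insert b B) := by
  rcases h with h | ⟨h1, h2, h3⟩
  · exact Or.inl (gateR_mono h)
  · refine Or.inr ⟨Finset.mem_insert_of_mem h1, ?_, ?_⟩
    · intro hm
      rcases Finset.mem_insert.1 hm with rfl | hm
      · rw [mk_zero_col] at ha; linarith
      · exact h2 hm
    · intro hm
      rcases Finset.mem_insert.1 hm with rfl | hm
      · rw [col_mk_sg, sg_not, mul_neg, sg_mul] at ha; linarith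
      · exact h3 hm

lemma side (a : Vx k N) : col a = 0 ∨ ∃ s, 1 ≤ sg s * col a := by
  rcases lt_trichotomy (col a) 0 with h | h | h
  · exact Or.inr ⟨false, by simp [sg]; omega⟩
  · exact Or.inl h
  · exact Or.inr ⟨true, by simp [sg]; omega⟩

lemma main_step (r : ℕ) (hM : Main (r + 1) A B) (haA : a ∉ A) (haB : a ∉ B) :
    ∃ b0, ∀ b, b0 ∈ insert a A ∪ insert b B → Main r (insert a A) (insert b B) := by
  rcases hM with ⟨s, h1, h2, h3⟩ | h | ⟨_, s, h1, h2, h3⟩ | ⟨_, rfl, hB⟩ | h | ⟨hr, rfl⟩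
  · -- hub and a leg held
    by_cases hc : 1 ≤ sg s * col a
    · refine ⟨mk (col a + sg s), fun b hb => Or.inl ⟨s, Finset.mem_insert_of_mem h1, ?_⟩⟩
      exact ⟨invL_in h2 hb, gate_in h3 hc⟩
    · refine ⟨mk (sg s), fun b hb => Or.inl ⟨s, Finset.mem_insert_of_mem h1, ?_⟩⟩
      exact ⟨invL_out h2 (by linarith), Or.inl (Or.inl hb)⟩
  · -- both legs held
    rcases side a with hc | ⟨s, hc⟩
    · refine ⟨a, fun b hb => Or.inr (Or.inl fun s => ?_)⟩
      exact ⟨invL_out (h s).1 (by rw [hc]; simp), gateR_mono (h s).2⟩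
    · refine ⟨mk (col a + sg s), fun b hb => Or.inr (Or.inl fun s' => ?_)⟩
      refine ⟨?_, gateR_mono (h s').2⟩
      by_cases hs : s' = s
      · subst hs
        exact invL_in (h s').1 hb
      · have : s' = !s := by cases s <;> cases s' <;> simp_all
        subst this
        exact invL_out (h _).1 (by rw [sg_not]; linarith)
  · -- undecided state
    have hA0 : ∀ x ∈ A, sg (!s) * col x ≤ 0 := fun x hx => by
      have := h1 x hx
      rw [sg_not]; linarith
    rcases side a with hc | ⟨s', hc⟩
    · refine ⟨mk (sg (!s)), fun b hb => Or.inr (Or.inl fun s' => ?_)⟩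
      by_cases hs : s' = s
      · subst hs
        exact ⟨invL_out h2 (by rw [hc]; simp), gateR_mono (Or.inl (Finset.mem_union_left _ h3))⟩
      · have : s' = !s := by cases s <;> cases s' <;> simp_all
        subst this
        refine ⟨invL_out (invL_vac hA0) (by rw [hc]; simp), Or.inl hb⟩
    · by_cases hs : s' = s
      · subst hs
        have hA1 : ∀ x ∈ insert a A, 1 ≤ sg s' * col x := by
          intro x hx
          rcases Finset.mem_insert.1 hx with rfl | hx
          · exact hc
          · exact h1 x hx
        rcases Nat.eq_zero_or_pos r with rfl | hr
        · refine ⟨mk 0, fun b hb => ?_⟩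
          have hb' : mk 0 ∈ insert b B := by
            rcases Finset.mem_union.1 hb with hb | hb
            · have := hA1 _ hb
              rw [mk_zero_col] at this
              linarith
            · exact hb
          refine Or.inr (Or.inr (Or.inr (Or.inr (Or.inl ⟨rfl, Or.inl ⟨Or.inr ⟨hb', ?_⟩, !s', ?_, ?_⟩⟩))))
          · intro x hx h0
            have := hA1 x hx
            rw [h0] at this
            linarith
          · exact invL_vac fun x hx => by
              have := hA1 x hx
              rw [sg_not]; linarith
          · exact Or.inl (Or.inr hb')
        · refine ⟨mk (col a + sg s'), fun b hb => ?_⟩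
          exact Or.inr (Or.inr (Or.inl ⟨hr, s', hA1, invL_in h2 hb, Finset.mem_insert_of_mem h3⟩))
      · have : s' = !s := by cases s <;> cases s' <;> simp_all
        subst this
        refine ⟨.hub, fun b hb => Or.inl ⟨s, ?_, ?_, ?_⟩⟩
        · rcases Finset.mem_union.1 hb with hb | hb
          · exfalso
            rcases Finset.mem_insert.1 hb with hb | hb
            · rw [← hb] at hc; simp [col] at hc
            · have := h1 _ hb
              simp [col] at this
          · exact hb
        · exact invL_out h2 (by rw [sg_not] at hc; linarith)
        · exact Or.inl (gateR_mono (Or.inl (Finset.mem_union_left _ h3)))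
  · -- A opened at the centre
    have : ∃ s, sg s * col a ≤ 0 := by
      rcases le_total (col a) 0 with h | h
      · exact ⟨true, by simpa [sg] using h⟩
      · exact ⟨false, by simpa [sg] using h⟩
    obtain ⟨s, hs⟩ := this
    refine ⟨mk (sg s), fun b hb => Or.inl ⟨s, Finset.mem_insert_of_mem hB, ?_, Or.inl (Or.inl hb)⟩⟩
    refine invL_out (invL_vac ?_) hs
    intro x hx
    rw [Finset.mem_singleton.1 hx, mk_zero_col]
    simp
  · omega
  · -- first move
    rcases side a with hc | ⟨s, hc⟩
    · by_cases h0 : a = mk 0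
      · subst h0
        refine ⟨.hub, fun b hb => ?_⟩
        refine Or.inr (Or.inr (Or.inr (Or.inl ⟨by omega, rfl, ?_⟩)))
        simpa [mk] using hb
      · refine ⟨mk 0, fun b hb => Or.inr (Or.inl fun s => ⟨?_, Or.inr ?_⟩)⟩
        · exact invL_out (invL_vac (by simp)) (by rw [hc]; simp)
        · simp only [Finset.mem_union, Finset.mem_insert, Finset.notMem_empty, or_false] at hb ⊢
          rcases hb with hb | hb
          · exact absurd hb.symm h0
          · exact hb
    · by_cases h0 : a = mk (sg s)
      · refine ⟨mk (col a + sg s), fun b hb => Or.inr (Or.inr (Or.inl ⟨by omega, s, ?_, ?_, ?_⟩))⟩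
        · intro x hx
          have : x = a := by simpa using hx
          rw [this]; exact hc
        · exact invL_in (invL_vac (by simp)) hb
        · rw [h0]; simp
      · refine ⟨.hub, fun b hb => Or.inl ⟨!s, ?_, ?_, ?_⟩⟩
        · simp only [Finset.mem_union, Finset.mem_insert, Finset.notMem_empty, or_false] at hb ⊢
          rcases hb with hb | hb
          · rw [← hb] at hc; simp [col] at hc
          · exact hb
        · exact invL_out (invL_vac (by simp)) (by rw [sg_not]; linarith)
        · refine Or.inr ⟨?_, ?_, ?_⟩
          · simp only [Finset.mem_union, Finset.mem_insert, Finset.notMem_empty, or_false] at hb ⊢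
            rcases hb with hb | hb
            · rw [← hb] at hc; simp [col] at hc
            · exact hb
          · intro hm
            have : mk 0 = a := by simpa using hm
            rw [← this, mk_zero_col] at hc
            linarith
          · intro hm
            rw [Bool.not_not] at hm
            have : mk (sg s) = a := by simpa using hm
            exact h0 this.symm

end step

def Inv (t : ℕ) (r : ℕ) (A B : Finset (Vx k N)) : Prop :=
  r ≤ t ∧ A.card = t - r ∧ B.card = t - r ∧ Disjoint A B ∧ Main r A B

lemma inv_step (t : ℕ) (hcard : 2 * t ≤ Fintype.card (Vx k N)) (r : ℕ) (A B : Finset (Vx k N))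
    (a : Vx k N) (h : Inv t (r + 1) A B) (haA : a ∉ A) (haB : a ∉ B) :
    ∃ b, b ∉ insert a A ∧ b ∉ B ∧ Inv t r (insert a A) (insert b B) := by
  obtain ⟨hr, cA, cB, hd, hM⟩ := h
  obtain ⟨b0, hb0⟩ := main_step r hM haA haB
  have cA' : (insert a A).card = t - r := by rw [Finset.card_insert_of_notMem haA]; omega
  have hex : ∃ b, b ∉ insert a A ∧ b ∉ B ∧ b0 ∈ insert a A ∪ insert b B := by
    by_cases hc : b0 ∈ insert a A ∪ B
    · have hlt : (insert a A ∪ B).card < (Finset.univ : Finset (Vx k N)).card := by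
        have := Finset.card_union_le (insert a A) B
        rw [Finset.card_univ]
        omega
      obtain ⟨b, _, hb⟩ := Finset.exists_mem_notMem_of_card_lt_card hlt
      rw [Finset.mem_union, not_or] at hb
      refine ⟨b, hb.1, hb.2, ?_⟩
      rcases Finset.mem_union.1 hc with hc | hc
      · exact Finset.mem_union_left _ hc
      · exact Finset.mem_union_right _ (Finset.mem_insert_of_mem hc)
    · rw [Finset.mem_union, not_or] at hc
      exact ⟨b0, hc.1, hc.2, Finset.mem_union_right _ (Finset.mem_insert_self _ _)⟩
  obtain ⟨b, hb1, hb2, hb3⟩ := hex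
  refine ⟨b, hb1, hb2, by omega, cA', ?_, ?_, hb0 b hb3⟩
  · rw [Finset.card_insert_of_notMem hb2]; omega
  · rw [Finset.disjoint_insert_right, Finset.disjoint_insert_left]
    exact ⟨hb1, haB, hd⟩

lemma value_le (t : ℕ) (ht : 2 ≤ t) (hcard : 2 * t ≤ Fintype.card (Vx k N)) :
    gameValue (TG k N) t ∅ ∅ ≤ ((Fintype.card (Set.Icc (-(3 : ℤ) ^ k) (3 ^ k)) + 1 + k * N
      + t + 2 * (t * N) : ℕ) : ℝ) := by
  refine gameValue_le (TG k N) _ (Nat.cast_nonneg _) (Inv t) ?_ (inv_step t hcard) t ∅ ∅ ?_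
  · rintro A B ⟨_, cA, _, hd, hM⟩
    have := score_final A B hd (main_zero A B hM)
    rwa [cA, Nat.sub_zero] at this
  · refine ⟨le_rfl, by simp, by simp, by simp, ?_⟩
    exact Or.inr (Or.inr (Or.inr (Or.inr (Or.inr ⟨ht, rfl⟩))))

end Vor

/-- For every `ε > 0` and every integer `t ≥ 2`, there is a finite tree `T`
with `2t ≤ |V(T)|` such that `VR(T, t) < 1/3 + ε`. -/
theorem vr_tree_close_to_third (ε : ℝ) (hε : 0 < ε) (t : ℕ) (ht : 2 ≤ t) :
    ∃ (n : ℕ) (T : SimpleGraph (Fin n)),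
      T.Connected ∧ T.IsAcyclic ∧ 2 * t ≤ n ∧ VR T t < 1 / 3 + ε := by
  obtain ⟨k, hk⟩ := exists_nat_gt (t / ε : ℝ)
  rw [div_lt_iff₀ hε] at hk
  have hk1 : 1 ≤ k := by
    rcases Nat.eq_zero_or_pos k with rfl | h
    · have : (2 : ℝ) ≤ t := by exact_mod_cast ht
      simp at hk
      linarith
    · exact h
  obtain ⟨c, hc⟩ : ∃ c, c = Fintype.card (Set.Icc (-(3 : ℤ) ^ k) (3 ^ k)) := ⟨_, rfl⟩
  set N := c + t + 2 with hN
  have hcv : Fintype.card (Vor.Vx k N) = c + 1 + 3 * (k * N) := by rw [Vor.card_vx, hc]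
  have hkN : N ≤ k * N := Nat.le_mul_of_pos_left _ hk1
  have hcard : 2 * t ≤ Fintype.card (Vor.Vx k N) := by rw [hcv]; omega
  let e0 : Vor.Vx k N ≃ Fin (Fintype.card (Vor.Vx k N)) := Fintype.equivFin _
  let T : SimpleGraph (Fin (Fintype.card (Vor.Vx k N))) := (Vor.TG k N).map e0.toEmbedding
  let e : Vor.TG k N ≃g T := SimpleGraph.Iso.map e0 (Vor.TG k N)
  refine ⟨_, T, e.connected_iff.1 Vor.connected, e.isAcyclic_iff.1 Vor.isTree.isAcyclic, hcard, ?_⟩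
  have hval := Vor.gameValue_iso (Vor.TG k N) T e Vor.connected t ∅ ∅
  rw [Finset.map_empty] at hval
  have hle := Vor.value_le t ht hcard
  rw [← hc] at hle
  unfold VR
  have hpos : (0 : ℝ) < Fintype.card (Fin (Fintype.card (Vor.Vx k N))) := by
    rw [Fintype.card_fin, hcv]; positivity
  rw [div_lt_iff₀ hpos]
  have hval' : gameValue T t ∅ ∅ = gameValue (Vor.TG k N) t ∅ ∅ := hval
  rw [hval', Fintype.card_fin, hcv]
  refine lt_of_le_of_lt hle ?_
  have hNr : (N : ℝ) = c + t + 2 := by rw [hN]; push_cast; ring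
  have hNpos : (0 : ℝ) < N := by rw [hNr]; positivity
  have h1 : (t : ℝ) * N < k * ε * N := mul_lt_mul_of_pos_right hk hNpos
  have ht' : (2 : ℝ) ≤ t := by exact_mod_cast ht
  have h2 : (2 : ℝ) * N ≤ t * N := mul_le_mul_of_nonneg_right ht' hNpos.le
  have hc0 : (0 : ℝ) ≤ c := Nat.cast_nonneg _
  have h3 : 0 ≤ ε * (c + 1) := by positivity
  push_cast
  nlinarith
end

section
/- For every integer Δ ≥ 4, every integer t ≥ 1, and every real ε > 0, there exists a finite connected graph G with maximum degree Δ and 2t ≤ |V(G)| such that VR(G, t) ≥ 1 − 1/Δ − ε. -/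
open SimpleGraph

variable {V : Type*}

namespace VoronoiAux

/-! ### Invariance of the game value under graph isomorphism -/

lemma dist_le_of_iso {V W : Type*} {G : SimpleGraph V} {H : SimpleGraph W} (e : G ≃g H)
    (hG : G.Connected) (u v : V) : H.dist (e u) (e v) ≤ G.dist u v := by
  obtain ⟨p, hp⟩ := hG.exists_walk_length_eq_dist u v
  rw [← hp, ← SimpleGraph.Walk.length_map e.toHom p]
  exact SimpleGraph.dist_le _

lemma dist_iso {V W : Type*} {G : SimpleGraph V} {H : SimpleGraph W} (e : G ≃g H)
    (hG : G.Connected) (hH : H.Connected) (u v : V) : H.dist (e u) (e v) = G.dist u v := by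
  apply le_antisymm (dist_le_of_iso e hG u v)
  have := dist_le_of_iso e.symm hH (e u) (e v)
  simpa using this

lemma gameValue_iso {V W : Type*} [Fintype V] [DecidableEq V] [Fintype W] [DecidableEq W]
    {G : SimpleGraph V} {H : SimpleGraph W} (e : G ≃g H)
    (hG : G.Connected) (hH : H.Connected) (t : ℕ) :
    ∀ A B : Finset V, gameValue H t (A.map e.toEquiv.toEmbedding) (B.map e.toEquiv.toEmbedding)
      = gameValue G t A B := by
  have hd : ∀ (S : Finset V) (v : V),
      distToSet H (S.map e.toEquiv.toEmbedding) (e v) = distToSet G S v := by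
    intro S v
    unfold distToSet
    rw [Finset.inf_map]
    apply Finset.inf_congr rfl
    intro a _
    have := dist_iso e hG hH a v
    simp only [Function.comp]
    exact_mod_cast this
  induction t with
  | zero =>
    intro A B
    simp only [gameValue, scoreA]
    rw [← Equiv.sum_comp e.toEquiv]
    apply Finset.sum_congr rfl
    intro v _
    have h1 := hd A v
    have h2 := hd B v
    change (if distToSet H _ (e v) < distToSet H _ (e v) then (1:ℝ) else
      if distToSet H _ (e v) = distToSet H _ (e v) then 1/2 else 0) = _
    rw [h1, h2]
  | succ t ih =>
    intro A B
    have hmem : ∀ (S : Finset V) (v : V), e v ∈ S.map e.toEquiv.toEmbedding ↔ v ∈ S := by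
      intro S v
      exact Finset.mem_map' e.toEquiv.toEmbedding
    have hins : ∀ (S : Finset V) (v : V), insert (e v) (S.map e.toEquiv.toEmbedding)
        = (insert v S).map e.toEquiv.toEmbedding := by
      intro S v
      rw [Finset.map_insert]; rfl
    simp only [gameValue]
    congr 1
    ext r
    simp only [Set.mem_ofPred_eq]
    rw [e.surjective.exists]
    apply exists_congr
    intro a
    rw [hmem, hmem, hins]
    have : {s : ℝ | ∃ b, b ∉ (insert a A).map e.toEquiv.toEmbedding ∧
          b ∉ B.map e.toEquiv.toEmbedding ∧
          s = gameValue H t ((insert a A).map e.toEquiv.toEmbedding)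
            (insert b (B.map e.toEquiv.toEmbedding))}
        = {s : ℝ | ∃ b, b ∉ insert a A ∧ b ∉ B ∧
          s = gameValue G t (insert a A) (insert b B)} := by
      ext s
      simp only [Set.mem_ofPred_eq]
      rw [e.surjective.exists]
      apply exists_congr
      intro b
      rw [hmem, hmem, hins, ih]
    rw [this]

/-! ### A strategy lemma -/

lemma finite_moves {V : Type*} [Fintype V] (P : V → Prop) (f : V → ℝ) :
    {r : ℝ | ∃ a, P a ∧ r = f a}.Finite := by
  apply (Set.finite_range f).subset
  rintro r ⟨a, _, rfl⟩
  exact ⟨a, rfl⟩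

lemma exists_free {V : Type*} [Fintype V] [DecidableEq V] (A B : Finset V)
    (h : A.card + B.card < Fintype.card V) : ∃ v, v ∉ A ∧ v ∉ B := by
  by_contra hc
  push Not at hc
  have : (Finset.univ : Finset V) ⊆ A ∪ B := by
    intro v _
    rw [Finset.mem_union]
    by_cases hv : v ∈ A
    · exact Or.inl hv
    · exact Or.inr (hc v hv)
  have h1 := Finset.card_le_card this
  have h2 := Finset.card_union_le A B
  rw [Finset.card_univ] at h1
  omega

lemma le_move {V : Type*} [Fintype V] [DecidableEq V] (G : SimpleGraph V) (k : ℕ)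
    (A B : Finset V) (v : ℝ) (a : V) (haA : a ∉ A) (haB : a ∉ B)
    (hcard : (insert a A).card + B.card < Fintype.card V)
    (h : ∀ b, b ∉ insert a A → b ∉ B → v ≤ gameValue G k (insert a A) (insert b B)) :
    v ≤ gameValue G (k+1) A B := by
  simp only [gameValue]
  have hfin : {r : ℝ | ∃ a, a ∉ A ∧ a ∉ B ∧
        r = sInf {s : ℝ | ∃ b, b ∉ insert a A ∧ b ∉ B ∧
          s = gameValue G k (insert a A) (insert b B)}}.Finite := by
    refine (finite_moves (fun a => a ∉ A ∧ a ∉ B) (fun a => sInf {s : ℝ | ∃ b, b ∉ insert a A ∧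
      b ∉ B ∧ s = gameValue G k (insert a A) (insert b B)})).subset ?_
    rintro r ⟨a, h1, h2, h3⟩
    exact ⟨a, ⟨h1, h2⟩, h3⟩
  refine le_trans ?_ (le_csSup hfin.bddAbove ⟨a, haA, haB, rfl⟩)
  apply le_csInf
  · obtain ⟨b, hb1, hb2⟩ := exists_free _ _ hcard
    exact ⟨_, b, hb1, hb2, rfl⟩
  · rintro s ⟨b, hb1, hb2, rfl⟩
    exact h b hb1 hb2

lemma strategy {V : Type*} [Fintype V] [DecidableEq V] (G : SimpleGraph V) (t : ℕ)
    (ht : 1 ≤ t) (hn : 2 * t ≤ Fintype.card V) (v : ℝ)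
    (J : Finset V → Finset V → Prop) (c : V) (h0 : J {c} ∅)
    (hstep : ∀ A B b, J A B → b ∉ A → b ∉ B →
      A.card + (insert b B).card < Fintype.card V →
      ∃ a, a ∉ A ∧ a ∉ insert b B ∧ J (insert a A) (insert b B))
    (hend : ∀ A B b, J A B → b ∉ A → b ∉ B → (insert b B).card ≤ t →
      v ≤ scoreA G A (insert b B)) :
    v ≤ gameValue G t ∅ ∅ := by
  have key : ∀ k (A B : Finset V) (b : V), J A B → b ∉ A → b ∉ B → A.card = B.card + 1 →
      B.card + k + 1 = t → v ≤ gameValue G k A (insert b B) := by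
    intro k
    induction k with
    | zero =>
      intro A B b hJ hbA hbB hc hk
      simp only [gameValue]
      apply hend A B b hJ hbA hbB
      rw [Finset.card_insert_of_notMem hbB]; omega
    | succ k ih =>
      intro A B b hJ hbA hbB hc hk
      have hcb := Finset.card_insert_of_notMem hbB
      obtain ⟨a, ha1, ha2, ha3⟩ := hstep A B b hJ hbA hbB (by omega)
      have hca := Finset.card_insert_of_notMem ha1
      apply le_move G k A (insert b B) v a ha1 ha2 (by omega)
      intro b' hb1 hb2
      exact ih _ _ b' ha3 hb1 hb2 (by omega) (by omega)
  obtain ⟨k, rfl⟩ : ∃ k, t = k + 1 := ⟨t - 1, by omega⟩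
  apply le_move G k ∅ ∅ v c (by simp) (by simp) (by simp; omega)
  intro b hb1 hb2
  exact key k _ _ b (by simpa using h0) hb1 hb2 (by simp) (by simp)

/-! ### The graph: a spider with `D` spines of length `3 ^ J`, with long paths (of length `M`)
hanging at the positions `3 ^ j` of every spine. -/

abbrev Vt (D J M : ℕ) := Option (Fin D × (Fin (3 ^ J) ⊕ (Fin J × Fin M)))

variable {D J M : ℕ}

lemma pow_pred_lt (j : Fin J) : 3 ^ (j : ℕ) - 1 < 3 ^ J := by
  have h1 : 3 ^ (j : ℕ) < 3 ^ J := Nat.pow_lt_pow_right (by norm_num) j.2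
  have h2 : 0 < 3 ^ (j : ℕ) := by positivity
  omega

/-- The spine vertex at which the `j`-th path hangs. -/
def att (j : Fin J) : Fin (3 ^ J) := ⟨3 ^ (j : ℕ) - 1, pow_pred_lt j⟩

def par : Vt D J M → Vt D J M
  | none => none
  | some (i, Sum.inl y) => if y.val = 0 then none else some (i, Sum.inl ⟨y.val - 1, by omega⟩)
  | some (i, Sum.inr (j, m)) =>
      if m.val = 0 then some (i, Sum.inl (att j)) else some (i, Sum.inr (j, ⟨m.val - 1, by omega⟩))

def pos : Vt D J M → ℕ
  | none => 0
  | some (_, Sum.inl y) => y.val + 1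
  | some (_, Sum.inr (j, _)) => 3 ^ (j : ℕ)

def hgt : Vt D J M → ℕ
  | none => 0
  | some (_, Sum.inl _) => 0
  | some (_, Sum.inr (_, m)) => m.val + 1

def leg : Vt D J M → Option (Fin D)
  | none => none
  | some (i, _) => some i

lemma lab_inj : Function.Injective (fun v : Vt D J M => (leg v, pos v, hgt v)) := by
  rintro (_ | ⟨i, y | ⟨j, m⟩⟩) (_ | ⟨i', y' | ⟨j', m'⟩⟩) h <;>
    simp [leg, pos, hgt] at h ⊢
  · exact ⟨h.1, Fin.ext h.2⟩
  · exact ⟨h.1, Fin.ext h.2.1, Fin.ext h.2.2⟩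

/-- The spider. -/
def Sp (D J M : ℕ) : SimpleGraph (Vt D J M) := SimpleGraph.fromRel (fun u v => par u = v)

lemma adj_par (v : Vt D J M) (h : v ≠ par v) : (Sp D J M).Adj v (par v) := by
  rw [Sp, SimpleGraph.fromRel_adj]
  exact ⟨h, Or.inl rfl⟩

lemma reach_par (v : Vt D J M) : (Sp D J M).Reachable v (par v) := by
  by_cases h : v = par v
  · rw [← h]
  · exact (adj_par v h).reachable

lemma dist_par (v : Vt D J M) : (Sp D J M).dist (par v) v ≤ 1 := by
  by_cases h : v = par v
  · rw [← h]; simp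
  · exact le_of_eq (SimpleGraph.dist_eq_one_iff_adj.mpr (adj_par v h).symm)

lemma reach_spine (i : Fin D) (n : ℕ) : ∀ h : n < 3 ^ J,
    (Sp D J M).Reachable (some (i, Sum.inl ⟨n, h⟩)) none := by
  induction n with
  | zero => intro h; simpa [par] using reach_par (M := M) (some (i, Sum.inl ⟨0, h⟩))
  | succ n ih =>
    intro h
    refine SimpleGraph.Reachable.trans ?_ (ih (by omega))
    simpa [par] using reach_par (M := M) (some (i, Sum.inl ⟨n+1, h⟩))

lemma reach_hang (i : Fin D) (j : Fin J) (n : ℕ) : ∀ h : n < M,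
    (Sp D J M).Reachable (some (i, Sum.inr (j, ⟨n, h⟩))) none := by
  induction n with
  | zero =>
    intro h
    refine SimpleGraph.Reachable.trans ?_ (reach_spine i _ (pow_pred_lt j))
    simpa [par, att] using reach_par (D := D) (some (i, Sum.inr (j, ⟨0, h⟩)))
  | succ n ih =>
    intro h
    refine SimpleGraph.Reachable.trans ?_ (ih (by omega))
    simpa [par] using reach_par (D := D) (some (i, Sum.inr (j, ⟨n+1, h⟩)))

lemma Sp_conn : (Sp D J M).Connected := by
  have h : ∀ v : Vt D J M, (Sp D J M).Reachable v none := by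
    rintro (_ | ⟨i, y | ⟨j, m⟩⟩)
    · exact SimpleGraph.Reachable.refl _
    · exact reach_spine i y.1 y.2
    · exact reach_hang i j m.1 m.2
  exact ⟨fun u v => (h u).trans (h v).symm⟩

/-! ### Degrees -/

lemma nbr_none : ((Sp D J M).neighborSet none).ncard = D := by
  have hpos : 0 < 3 ^ J := by positivity
  have : (Sp D J M).neighborSet none
      = Set.range (fun i : Fin D => (some (i, Sum.inl ⟨0, hpos⟩) : Vt D J M)) := by
    ext v
    rw [SimpleGraph.mem_neighborSet, Sp, SimpleGraph.fromRel_adj]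
    rcases v with (_ | ⟨i, y | ⟨j, m⟩⟩)
    · simp
    · simp only [par, Set.mem_range]
      constructor
      · rintro ⟨_, h⟩
        refine ⟨i, ?_⟩
        have : y.val = 0 := by
          by_contra h0
          simp [h0] at h
        congr 3
        exact Fin.ext this.symm
      · rintro ⟨i', h⟩
        simp at h
        simp [← h.2]
    · simp only [par, Set.mem_range]
      by_cases h : m.val = 0 <;> simp [h]
  rw [this, ← Set.image_univ, Set.ncard_image_of_injective]
  · simp
  · intro a b h
    simpa using h

lemma nbr_some (v : Vt D J M) (hv : v ≠ none) : ((Sp D J M).neighborSet v).ncard ≤ 3 := by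
  rw [← Set.ncard_image_of_injective _ (lab_inj (D := D) (J := J) (M := M))]
  have hsub : (fun v : Vt D J M => (leg v, pos v, hgt v)) '' (Sp D J M).neighborSet v
      ⊆ ({(leg (par v), pos (par v), hgt (par v)), (leg v, pos v + 1, hgt v),
          (leg v, pos v, hgt v + 1)} : Finset (Option (Fin D) × ℕ × ℕ)) := by
    rintro _ ⟨w, hw, rfl⟩
    rw [SimpleGraph.mem_neighborSet, Sp, SimpleGraph.fromRel_adj] at hw
    simp only [Finset.coe_insert, Finset.coe_singleton, Set.mem_insert_iff,
      Set.mem_singleton_iff]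
    rcases hw with ⟨_, h | h⟩
    · left; rw [h]
    · right
      rcases w with (_ | ⟨i, y | ⟨j, m⟩⟩)
      · exact absurd h.symm hv
      · left
        by_cases h0 : y.val = 0
        · simp [par, h0] at h; exact absurd h.symm hv
        · simp [par, h0] at h
          subst h
          simp [leg, pos, hgt]; omega
      · right
        by_cases h0 : m.val = 0
        · simp [par, h0] at h
          subst h
          have : 0 < 3 ^ (j : ℕ) := by positivity
          simp [leg, pos, hgt, att, h0]; omega
        · simp [par, h0] at h
          subst h
          simp [leg, pos, hgt]; omega
  refine le_trans (Set.ncard_le_ncard hsub (Finset.finite_toSet _)) ?_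
  rw [Set.ncard_coe_finset]
  exact Finset.card_le_three

/-! ### Distances -/

lemma dist_step (u v : Vt D J M) : (Sp D J M).dist u v ≤ (Sp D J M).dist u (par v) + 1 :=
  le_trans (Sp_conn.dist_triangle) (Nat.add_le_add_left (dist_par v) _)

lemma dist_none_spine (i : Fin D) (n : ℕ) : ∀ h : n < 3 ^ J,
    (Sp D J M).dist none (some (i, Sum.inl ⟨n, h⟩)) ≤ n + 1 := by
  induction n with
  | zero =>
    intro h
    have := dist_step (M := M) none (some (i, Sum.inl ⟨0, h⟩))
    simpa [par] using this
  | succ n ih =>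
    intro h
    have := dist_step (M := M) none (some (i, Sum.inl ⟨n+1, h⟩))
    simp [par] at this
    have := ih (by omega)
    omega

lemma dist_spine (i : Fin D) (a : Fin (3 ^ J)) (n : ℕ) : ∀ h : a.val + n < 3 ^ J,
    (Sp D J M).dist (some (i, Sum.inl a)) (some (i, Sum.inl ⟨a.val + n, h⟩)) ≤ n := by
  induction n with
  | zero => intro h; simp
  | succ n ih =>
    intro h
    have h1 := dist_step (M := M) (some (i, Sum.inl a)) (some (i, Sum.inl ⟨a.val + n+1, h⟩))
    simp [par] at h1
    have h2 := ih (by omega)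
    have h3 : (Sp D J M).dist (some (i, Sum.inl a)) (some (i, Sum.inl ⟨a.val + n + 1, h⟩))
      ≤ n + 1 := by omega
    exact h3

lemma dist_hang (u : Vt D J M) (i : Fin D) (j : Fin J) (n : ℕ) : ∀ h : n < M,
    (Sp D J M).dist u (some (i, Sum.inr (j, ⟨n, h⟩)))
      ≤ (Sp D J M).dist u (some (i, Sum.inl (att j))) + (n + 1) := by
  induction n with
  | zero =>
    intro h
    have := dist_step u (some (i, Sum.inr (j, ⟨0, h⟩)))
    simpa [par] using this
  | succ n ih =>
    intro h
    have := dist_step u (some (i, Sum.inr (j, ⟨n+1, h⟩)))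
    simp [par] at this
    have := ih (by omega)
    omega

lemma dist_none_hang (i : Fin D) (j : Fin J) (m : Fin M) :
    (Sp D J M).dist none (some (i, Sum.inr (j, m))) ≤ 3 ^ (j : ℕ) + (m.val + 1) := by
  have h1 := dist_hang none i j m.1 m.2
  have h2 := dist_none_spine (M := M) i _ (pow_pred_lt j)
  have : 0 < 3 ^ (j : ℕ) := by positivity
  change (Sp D J M).dist none (some (i, Sum.inl (att j))) ≤ _ at h2
  change (Sp D J M).dist none (some (i, Sum.inr (j, m))) ≤ _ at h1
  omega

lemma dist_spine_hang (i : Fin D) (a : Fin (3 ^ J)) (j : Fin J) (m : Fin M)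
    (ha : a.val + 1 ≤ 3 ^ (j : ℕ)) :
    (Sp D J M).dist (some (i, Sum.inl a)) (some (i, Sum.inr (j, m)))
      ≤ 3 ^ (j : ℕ) - (a.val + 1) + (m.val + 1) := by
  have h1 := dist_hang (some (i, Sum.inl a)) i j m.1 m.2
  have hj := pow_pred_lt j
  have h2 := dist_spine (M := M) i a (3 ^ (j : ℕ) - (a.val + 1)) (by omega)
  have h3 : (⟨a.val + (3 ^ (j : ℕ) - (a.val + 1)), by omega⟩ : Fin (3 ^ J)) = att j := by
    apply Fin.ext
    simp [att]; omega
  rw [h3] at h2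
  change (Sp D J M).dist _ (some (i, Sum.inr (j, m))) ≤ _ at h1
  omega

lemma lip {V : Type*} {G : SimpleGraph V} (f : V → ℤ) (hf : ∀ u v, G.Adj u v → f v - f u ≤ 1)
    {u v : V} (p : G.Walk u v) : f v - f u ≤ p.length := by
  induction p with
  | nil => simp
  | cons h p ih =>
    have := hf _ _ h
    simp only [SimpleGraph.Walk.length_cons]
    push_cast
    omega

/-- Signed distance from the spine vertex of the `j`-th hanging path of leg `i`. -/
def pot (i : Fin D) (j : Fin J) : Vt D J M → ℤ
  | none => -(3 ^ (j : ℕ) : ℕ)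
  | some (i', Sum.inl y) =>
      if i' = i then -|((y.val + 1 : ℕ) : ℤ) - (3 ^ (j : ℕ) : ℕ)|
      else -((3 ^ (j : ℕ) : ℕ) + (y.val + 1 : ℕ) : ℤ)
  | some (i', Sum.inr (j', m)) =>
      if i' = i then
        if j' = j then (m.val + 1 : ℕ) else -|((3 ^ (j' : ℕ) : ℕ) : ℤ) - (3 ^ (j : ℕ) : ℕ)|
      else -((3 ^ (j : ℕ) : ℕ) + (3 ^ (j' : ℕ) : ℕ) : ℤ)

lemma pot_par (i : Fin D) (j : Fin J) (v : Vt D J M) : |pot i j v - pot i j (par v)| ≤ 1 := by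
  have hx : 0 < 3 ^ (j : ℕ) := by positivity
  rcases v with (_ | ⟨i', y | ⟨j', m⟩⟩)
  · simp [par]
  · simp only [par]
    generalize hX : 3 ^ (j : ℕ) = x at *
    split_ifs with h0 <;> simp only [pot, hX] <;> by_cases hi : i' = i <;>
      simp only [hi, if_true, if_false] <;> grind
  · have hx' : 0 < 3 ^ (j' : ℕ) := by positivity
    simp only [par]
    split_ifs with h0 <;> simp only [pot, att] <;> by_cases hi : i' = i <;>
      by_cases hj : j' = j <;>
      simp only [hi, hj, if_true, if_false]
    all_goals
      generalize 3 ^ (j : ℕ) = x at *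
      generalize 3 ^ (j' : ℕ) = x' at *
      grind

lemma dist_ge (i : Fin D) (j : Fin J) (u v : Vt D J M) :
    pot i j v - pot i j u ≤ (Sp D J M).dist u v := by
  obtain ⟨p, hp⟩ := (Sp_conn (D := D) (J := J) (M := M)).exists_walk_length_eq_dist u v
  rw [← hp]
  apply lip
  intro a b hab
  rw [Sp, SimpleGraph.fromRel_adj] at hab
  rcases hab with ⟨_, h | h⟩
  · have := pot_par i j a
    rw [h, abs_le] at this
    omega
  · have := pot_par i j b
    rw [h, abs_le] at this
    omega

/-! ### The strategy -/

/-- `b` has been answered: behind it (away from the centre) on the spine of its leg, every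
vertex not in `B` is shielded by a vertex in `A`. -/
def Ans (A B : Finset (Vt D J M)) (b : Vt D J M) : Prop :=
  ∀ i, leg b = some i → ∀ u : Fin (3 ^ J), pos b < u.val + 1 →
    some (i, Sum.inl u) ∈ B ∨
      ∃ a : Fin (3 ^ J), some (i, Sum.inl a) ∈ A ∧ pos b < a.val + 1 ∧ a.val ≤ u.val

lemma Ans.mono {A B A' B' : Finset (Vt D J M)} {b : Vt D J M} (h : Ans A B b)
    (hA : A ⊆ A') (hB : B ⊆ B') : Ans A' B' b := by
  intro i hi u hu
  rcases h i hi u hu with h1 | ⟨a, h1, h2⟩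
  · exact Or.inl (hB h1)
  · exact Or.inr ⟨a, hA h1, h2⟩

def Inv (A B : Finset (Vt D J M)) : Prop :=
  none ∈ A ∧ Disjoint A B ∧ ∀ b ∈ B, Ans A B b

lemma inv_step (A B : Finset (Vt D J M)) (b : Vt D J M) (hI : Inv A B) (hbA : b ∉ A)
    (hc : A.card + (insert b B).card < Fintype.card (Vt D J M)) :
    ∃ a, a ∉ A ∧ a ∉ insert b B ∧ Inv (insert a A) (insert b B) := by
  obtain ⟨h0, hd, hans⟩ := hI
  suffices ∃ a, a ∉ A ∧ a ∉ insert b B ∧ Ans (insert a A) (insert b B) b by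
    obtain ⟨a, ha1, ha2, ha3⟩ := this
    refine ⟨a, ha1, ha2, Finset.mem_insert_of_mem h0, ?_, ?_⟩
    · rw [Finset.disjoint_insert_left, Finset.disjoint_insert_right]
      exact ⟨ha2, hbA, hd⟩
    · intro b' hb'
      rcases Finset.mem_insert.mp hb' with rfl | hb'
      · exact ha3
      · exact (hans b' hb').mono (Finset.subset_insert _ _) (Finset.subset_insert _ _)
  by_cases hA : Ans A (insert b B) b
  · obtain ⟨a, ha1, ha2⟩ := exists_free _ _ hc
    exact ⟨a, ha1, ha2, hA.mono (Finset.subset_insert _ _) (Finset.Subset.refl _)⟩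
  · unfold Ans at hA
    push Not at hA
    obtain ⟨i, hi, u, hu, huB, huA⟩ := hA
    let S : Finset (Fin (3 ^ J)) := Finset.univ.filter
      (fun w => pos b < w.val + 1 ∧ (some (i, Sum.inl w) : Vt D J M) ∉ insert b B)
    obtain ⟨w, hw, hmin⟩ := Finset.exists_min_image S (fun w => w.val)
      ⟨u, by simp only [S, Finset.mem_filter]; exact ⟨Finset.mem_univ _, hu, huB⟩⟩
    have hw' := (Finset.mem_filter.mp hw).2
    refine ⟨some (i, Sum.inl w), ?_, hw'.2, ?_⟩
    · intro hwA
      have h1 := huA w hwA hw'.1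
      have h2 := hmin u (by simp only [S, Finset.mem_filter]; exact ⟨Finset.mem_univ _, hu, huB⟩)
      omega
    · intro i' hi' u' hu'
      rw [hi] at hi'
      obtain rfl := Option.some.inj hi'
      by_cases hB : (some (i, Sum.inl u') : Vt D J M) ∈ insert b B
      · exact Or.inl hB
      · right
        refine ⟨w, Finset.mem_insert_self _ _, hw'.1, ?_⟩
        exact hmin u' (by simp only [S, Finset.mem_filter]; exact ⟨Finset.mem_univ _, hu', hB⟩)

/-- `b` directly attacks the `p.2`-th hanging path of leg `p.1`. -/
def Hit (b : Vt D J M) (p : Fin D × Fin J) : Prop :=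
  leg b = some p.1 ∧ 3 ^ (p.2 : ℕ) ≤ pos b ∧ pos b ≤ 2 * 3 ^ (p.2 : ℕ)

lemma hit_unique (b : Vt D J M) (p q : Fin D × Fin J) (hp : Hit b p) (hq : Hit b q) : p = q := by
  obtain ⟨h1, h2, h3⟩ := hp
  obtain ⟨g1, g2, g3⟩ := hq
  have e1 : p.1 = q.1 := by
    rw [h1] at g1; exact Option.some.inj g1
  have key : ∀ a c : ℕ, a < c → 3 ^ c ≤ pos b → pos b ≤ 2 * 3 ^ a → False := by
    intro a c hac k1 k2
    have : 3 ^ (a + 1) ≤ 3 ^ c := Nat.pow_le_pow_right (by norm_num) hac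
    have h0 : 0 < 3 ^ a := by positivity
    rw [pow_succ] at this
    omega
  have e2 : p.2 = q.2 := by
    apply Fin.ext
    rcases lt_trichotomy (p.2 : ℕ) q.2 with h | h | h
    · exact (key _ _ h g2 h3).elim
    · exact h
    · exact (key _ _ h h2 g3).elim
  exact Prod.ext e1 e2

lemma mass_good (A B : Finset (Vt D J M)) (b : Vt D J M) (hI : Inv A B) (hbA : b ∉ A)
    (p : Fin D × Fin J) (hb : leg b ≠ some p.1) (hhit : ∀ b' ∈ B, ¬ Hit b' p) (m : Fin M) :
    distToSet (Sp D J M) A (some (p.1, Sum.inr (p.2, m)))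
      < distToSet (Sp D J M) (insert b B) (some (p.1, Sum.inr (p.2, m))) := by
  obtain ⟨h0, hd, hans⟩ := hI
  obtain ⟨i, j⟩ := p
  have hx : 0 < 3 ^ (j : ℕ) := by positivity
  have hle : ∀ a ∈ A, distToSet (Sp D J M) A (some (i, Sum.inr (j, m)))
      ≤ ((Sp D J M).dist a (some (i, Sum.inr (j, m))) : ℕ∞) := by
    intro a ha
    exact Finset.inf_le (f := fun a => ((Sp D J M).dist a (some (i, Sum.inr (j, m))) : ℕ∞)) ha
  have htop : distToSet (Sp D J M) A (some (i, Sum.inr (j, m))) < ⊤ :=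
    lt_of_le_of_lt (hle none h0) (ENat.natCast_lt_top _)
  simp only
  conv_rhs => unfold distToSet
  rw [Finset.lt_inf_iff htop]
  intro b' hb'
  suffices ∃ a ∈ A, (Sp D J M).dist a (some (i, Sum.inr (j, m)))
      < (Sp D J M).dist b' (some (i, Sum.inr (j, m))) by
    obtain ⟨a, ha, hlt⟩ := this
    exact lt_of_le_of_lt (hle a ha) (by exact_mod_cast hlt)
  have hb'A : b' ∉ A := by
    rcases Finset.mem_insert.mp hb' with rfl | h
    · exact hbA
    · exact fun h' => Finset.disjoint_left.mp hd h' h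
  have hD := dist_ge i j b' (some (i, Sum.inr (j, m)))
  have hself : pot i j (some (i, Sum.inr (j, m)) : Vt D J M) = ((m.val + 1 : ℕ) : ℤ) := by
    simp [pot]
  rw [hself] at hD
  have hn := dist_none_hang i j m
  by_cases hl : leg b' = some i
  · have hb'B : b' ∈ B := by
      rcases Finset.mem_insert.mp hb' with rfl | h
      · exact absurd hl hb
      · exact h
    have hh := hhit b' hb'B
    have hh' : pos b' < 3 ^ (j : ℕ) ∨ 2 * 3 ^ (j : ℕ) < pos b' := by
      by_contra hc
      push Not at hc
      exact hh ⟨hl, hc.1, hc.2⟩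
    have hpot : pot i j b' = -|((pos b' : ℕ) : ℤ) - (3 ^ (j : ℕ) : ℕ)| := by
      rcases b' with (_ | ⟨i', y | ⟨j', m'⟩⟩)
      · simp [leg] at hl
      · simp [leg] at hl
        simp [pot, pos, hl]
      · simp [leg] at hl
        have hne : j' ≠ j := by
          rintro rfl
          simp only [pos] at hh'
          omega
        simp [pot, pos, hl, hne]
    rw [hpot] at hD
    rcases hh' with hlt | hgt
    · have ha := hans b' hb'B i hl (att j) (by simp only [att]; omega)
      rcases ha with h1 | ⟨a, haA, ha1, ha2⟩
      · exact absurd ⟨rfl, by simp only [pos, att]; omega, by simp only [pos, att]; omega⟩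
          (hhit _ h1)
      · simp only [att] at ha2
        refine ⟨_, haA, ?_⟩
        have h2 := dist_spine_hang i a j m (by omega)
        rw [abs_of_neg (by omega)] at hD
        omega
    · refine ⟨none, h0, ?_⟩
      rw [abs_of_pos (by omega)] at hD
      omega
  · refine ⟨none, h0, ?_⟩
    have hpot : pot i j b' = -((3 ^ (j : ℕ) : ℕ) + (pos b' : ℕ) : ℤ) ∧ 0 < pos b' := by
      rcases b' with (_ | ⟨i', y | ⟨j', m'⟩⟩)
      · exact absurd h0 hb'A
      · simp [leg] at hl
        simp [pot, pos, hl]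
      · simp [leg] at hl
        simp [pot, pos, hl]
    rw [hpot.1] at hD
    have := hpot.2
    omega

lemma score_ge (A B : Finset (Vt D J M)) (b : Vt D J M) (t : ℕ) (hI : Inv A B) (hbA : b ∉ A)
    (hcard : (insert b B).card ≤ t) :
    (((D : ℝ) - 1) * J - t) * M ≤ scoreA (Sp D J M) A (insert b B) := by
  classical
  let bad : Finset (Fin D × Fin J) := Finset.univ.filter (fun p => leg b = some p.1)
  let hit : Finset (Fin D × Fin J) := B.biUnion (fun b' => Finset.univ.filter (fun p => Hit b' p))
  let Gd : Finset (Fin D × Fin J) := Finset.univ \ (bad ∪ hit)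
  have hbad : bad.card ≤ J := by
    have : Set.InjOn (fun p : Fin D × Fin J => p.2) (bad : Set (Fin D × Fin J)) := by
      intro p hp q hq hpq
      have hp' := (Finset.mem_filter.mp hp).2
      have hq' := (Finset.mem_filter.mp hq).2
      rw [hp'] at hq'
      exact Prod.ext (Option.some.inj hq') hpq
    rw [← Finset.card_image_of_injOn this]
    exact le_trans (Finset.card_le_univ _) (by simp)
  have hhit : hit.card ≤ t := by
    have h1 : hit.card ≤ B.card * 1 := by
      apply Finset.card_biUnion_le_card_mul
      intro b' _
      rw [Finset.card_le_one]
      intro p hp q hq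
      exact hit_unique b' p q (Finset.mem_filter.mp hp).2 (Finset.mem_filter.mp hq).2
    have h2 := Finset.card_le_card (Finset.subset_insert b B)
    omega
  have hGd : D * J ≤ Gd.card + J + t := by
    have h1 := Finset.le_card_sdiff (bad ∪ hit) (Finset.univ : Finset (Fin D × Fin J))
    have h2 := Finset.card_union_le bad hit
    have h3 : (Finset.univ : Finset (Fin D × Fin J)).card = D * J := by simp
    rw [h3] at h1
    change _ ≤ Gd.card at h1
    omega
  let φ : (Fin D × Fin J) × Fin M → Vt D J M := fun q => some (q.1.1, Sum.inr (q.1.2, q.2))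
  have hφ : Function.Injective φ := by
    rintro ⟨⟨a, b⟩, c⟩ ⟨⟨a', b'⟩, c'⟩ h
    simp only [φ, Option.some.injEq, Prod.mk.injEq, Sum.inr.injEq] at h
    obtain ⟨rfl, rfl, rfl⟩ := h
    rfl
  let S : Finset (Vt D J M) := (Gd ×ˢ Finset.univ).image φ
  have hS : S.card = Gd.card * M := by
    rw [Finset.card_image_of_injective _ hφ, Finset.card_product]
    simp
  have hscore : (S.card : ℝ) ≤ scoreA (Sp D J M) A (insert b B) := by
    unfold scoreA
    refine le_trans ?_ (Finset.sum_le_univ_sum_of_nonneg (s := S) ?_)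
    · rw [Finset.card_eq_sum_ones]
      push_cast
      apply Finset.sum_le_sum
      intro v hv
      obtain ⟨⟨p, m⟩, hp, rfl⟩ := Finset.mem_image.mp hv
      have hp1 := (Finset.mem_product.mp hp).1
      simp only [Gd, Finset.mem_sdiff, Finset.mem_union, not_or, bad, hit, Finset.mem_filter,
        Finset.mem_biUnion, Finset.mem_univ, true_and, not_exists, not_and] at hp1
      have := mass_good A B b hI hbA p hp1.1 hp1.2 m
      rw [if_pos this]
    · intro v
      split_ifs <;> norm_num
  refine le_trans ?_ hscore
  rw [hS]
  push_cast
  apply mul_le_mul_of_nonneg_right _ (Nat.cast_nonneg M)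
  have : ((D * J : ℕ) : ℝ) ≤ ((Gd.card + J + t : ℕ) : ℝ) := by exact_mod_cast hGd
  push_cast at this
  linarith

lemma value_ge (t : ℕ) (ht : 1 ≤ t) (hn : 2 * t ≤ Fintype.card (Vt D J M)) :
    (((D : ℝ) - 1) * J - t) * M ≤ gameValue (Sp D J M) t ∅ ∅ := by
  apply strategy (Sp D J M) t ht hn _ Inv none
  · exact ⟨by simp, by simp, by simp⟩
  · intro A B b hI hbA _ hc
    exact inv_step A B b hI hbA hc
  · intro A B b hI hbA _ hc
    exact score_ge A B b t hI hbA hc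

end VoronoiAux

open VoronoiAux in
/-- For every integer `Δ ≥ 4`, every integer `t ≥ 1` and every `ε > 0`,
there is a finite connected graph `G` with maximum degree `Δ` and `2t ≤ |V(G)|` such that
`VR(G, t) ≥ 1 − 1/Δ − ε`. -/
theorem vr_max_degree_lower_bound (Δ t : ℕ) (hΔ : 4 ≤ Δ) (ht : 1 ≤ t) (ε : ℝ) (hε : 0 < ε) :
    ∃ (n : ℕ) (G : SimpleGraph (Fin n)), G.Connected ∧
      (∀ v, (G.neighborSet v).ncard ≤ Δ) ∧ (∃ v, (G.neighborSet v).ncard = Δ) ∧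
      2 * t ≤ n ∧ 1 - 1 / (Δ : ℝ) - ε ≤ VR G t := by
  obtain ⟨J, hJ⟩ : ∃ J : ℕ, (t : ℝ) ≤ ε * J ∧ t ≤ J := by
    obtain ⟨J, hJ⟩ := exists_nat_ge ((t : ℝ) / ε)
    refine ⟨J + t, ?_, by omega⟩
    rw [div_le_iff₀ hε] at hJ
    push_cast
    have : 0 ≤ ε * t := by positivity
    linarith
  obtain ⟨hJ1, hJ2⟩ := hJ
  let M := 1 + Δ * 3 ^ J
  have hcard : Fintype.card (Vt Δ J M) = Δ * (3 ^ J + J * M) + 1 := by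
    simp
  have hn : 2 * t ≤ Fintype.card (Vt Δ J M) := by
    rw [hcard]
    have h1 : 1 ≤ M := by simp [M]
    have h2 : J ≤ J * M := Nat.le_mul_of_pos_right _ h1
    have h3 : 4 * (3 ^ J + J * M) ≤ Δ * (3 ^ J + J * M) := Nat.mul_le_mul_right _ hΔ
    have h4 : 0 < 3 ^ J := by positivity
    omega
  let e := Fintype.equivFin (Vt Δ J M)
  let G : SimpleGraph (Fin (Fintype.card (Vt Δ J M))) := (Sp Δ J M).comap e.symm
  let f : Sp Δ J M ≃g G := (SimpleGraph.Iso.comap e.symm (Sp Δ J M)).symm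
  have hG : G.Connected := f.connected_iff.mp Sp_conn
  have hnb : ∀ v, (G.neighborSet (f v)).ncard = ((Sp Δ J M).neighborSet v).ncard := by
    intro v
    have : G.neighborSet (f v) = f '' ((Sp Δ J M).neighborSet v) := by
      ext w
      obtain ⟨w, rfl⟩ := f.surjective w
      rw [SimpleGraph.mem_neighborSet, f.map_adj_iff, f.injective.mem_set_image]
      rfl
    rw [this, Set.ncard_image_of_injective _ f.injective]
  refine ⟨_, G, hG, ?_, ⟨f none, ?_⟩, hn, ?_⟩
  · intro v
    obtain ⟨v, rfl⟩ := f.surjective v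
    rw [hnb]
    by_cases hv : v = none
    · rw [hv, nbr_none]
    · exact le_trans (nbr_some v hv) (by omega)
  · rw [hnb, nbr_none]
  · have hv := value_ge (D := Δ) (J := J) (M := M) t ht hn
    have hiso := gameValue_iso f Sp_conn hG t ∅ ∅
    rw [Finset.map_empty] at hiso
    unfold VR
    rw [hiso, Fintype.card_fin, hcard]
    rw [le_div_iff₀ (by positivity)]
    refine le_trans ?_ hv
    have hΔ' : (4 : ℝ) ≤ Δ := by exact_mod_cast hΔ
    have hM : (M : ℝ) = 1 + Δ * 3 ^ J := by simp [M]
    have ht' : (1 : ℝ) ≤ t := by exact_mod_cast ht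
    push_cast
    have hM0 : (0 : ℝ) ≤ M := Nat.cast_nonneg M
    have e1 : (1 - 1 / (Δ : ℝ) - ε) * (Δ * (3 ^ J + J * M) + 1)
        = (1 - 1 / (Δ : ℝ) - ε) * M + (Δ - 1) * J * M - (ε * J) * Δ * M := by
      have hne : (Δ : ℝ) ≠ 0 := by positivity
      have : (Δ * (3 ^ J + J * M) + 1 : ℝ) = M + Δ * (J * M) := by rw [hM]; ring
      rw [this]
      field_simp
      ring
    rw [e1]
    have e2 : (1 - 1 / (Δ : ℝ) - ε) * M ≤ 1 * M := by
      apply mul_le_mul_of_nonneg_right _ hM0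
      have : 0 ≤ 1 / (Δ : ℝ) := by positivity
      linarith
    have e3 : (t : ℝ) * 4 * M ≤ (ε * J) * Δ * M := by
      apply mul_le_mul_of_nonneg_right _ hM0
      apply mul_le_mul hJ1 hΔ' (by norm_num)
      positivity
    have e4 : (M : ℝ) ≤ t * M := le_mul_of_one_le_left hM0 ht'
    nlinarith
end
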